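/- arXiv:2101.01041 — 3 statements merged into one kernel-verified Lean document; each statement's English description precedes it below -/
import Mathlib

section
/- (Outer-loop global convergence, Gauss–Newton.) Suppose Assumption 2.4 holds, K⁰ ∈ 𝒦, and 0 < α ≤ 1/2. Define iterates K^{k+1}_t := K^k_t − 2α (G^{K^k}_t)⁻¹ F^{K^k}_t. Then for every integer M ≥ 1, (1/M) Σ_{k=0}^{M−1} Σ_{t=0}^{N−1} ‖F^{K^k}_t‖_F² ≤ (max_{0≤t≤N−1} ‖G^{K⁰}_t‖) · Σ_{t=0}^{N} Tr((P^{K⁰}_t − P*_t) Σ⁰_t) / (2αφM). -/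
open Matrix

noncomputable section

/-- Rayleigh-quotient value set of a square real matrix. -/
def rayleighSet {a : ℕ} (M : Matrix (Fin a) (Fin a) ℝ) : Set ℝ :=
  { r : ℝ | ∃ x : Fin a → ℝ, x ⬝ᵥ x = 1 ∧ r = x ⬝ᵥ M.mulVec x }

/-- Smallest eigenvalue (of a symmetric matrix), via the Rayleigh characterization. -/
def eigMin {a : ℕ} (M : Matrix (Fin a) (Fin a) ℝ) : ℝ := sInf (rayleighSet M)

/-- Largest eigenvalue (of a symmetric matrix), via the Rayleigh characterization. -/
def eigMax {a : ℕ} (M : Matrix (Fin a) (Fin a) ℝ) : ℝ := sSup (rayleighSet M)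

/-- Operator (spectral) norm of a real matrix. -/
def opNorm {a b : ℕ} (M : Matrix (Fin a) (Fin b) ℝ) : ℝ := Real.sqrt (eigMax (Mᵀ * M))

/-- Squared Frobenius norm. -/
def frobNormSq {a b : ℕ} (M : Matrix (Fin a) (Fin b) ℝ) : ℝ := ∑ i, ∑ j, (M i j) ^ 2

/-- Frobenius norm. -/
def frobNorm {a b : ℕ} (M : Matrix (Fin a) (Fin b) ℝ) : ℝ := Real.sqrt (frobNormSq M)

/-- Extend a finite tuple to a function on `ℕ` by zero. -/
def padZero {α : Type*} [Zero α] {N : ℕ} (f : Fin N → α) : ℕ → α :=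
  fun t => if h : t < N then f ⟨t, h⟩ else 0

/-- Data of a finite-horizon zero-sum LQ dynamic game with horizon `N`. -/
structure LQGame (m d n N : ℕ) where
  A : ℕ → Matrix (Fin m) (Fin m) ℝ
  B : ℕ → Matrix (Fin m) (Fin d) ℝ
  D : ℕ → Matrix (Fin m) (Fin n) ℝ
  Q : ℕ → Matrix (Fin m) (Fin m) ℝ
  QN : Matrix (Fin m) (Fin m) ℝ
  Ru : ℕ → Matrix (Fin d) (Fin d) ℝ
  Rw : ℕ → Matrix (Fin n) (Fin n) ℝ
  Sig : ℕ → Matrix (Fin m) (Fin m) ℝ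
  hQ : ∀ t < N, (Q t).PosSemidef
  hQN : QN.PosSemidef
  hRu : ∀ t < N, (Ru t).PosDef
  hRw : ∀ t < N, (Rw t).PosDef
  hSig : ∀ t ≤ N, (Sig t).PosDef

namespace LQGame

variable {m d n N : ℕ}

/-- Value matrices `P^{K,L}` indexed by the number `j` of steps before the terminal
time, i.e. `PKLaux g K L j = P^{K,L}_{N-j}`. -/
def PKLaux (g : LQGame m d n N) (K : ℕ → Matrix (Fin d) (Fin m) ℝ)
    (L : ℕ → Matrix (Fin n) (Fin m) ℝ) : ℕ → Matrix (Fin m) (Fin m) ℝ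
  | 0 => g.QN
  | j + 1 =>
      (g.A (N - (j+1)) - g.B (N - (j+1)) * K (N - (j+1)) - g.D (N - (j+1)) * L (N - (j+1)))ᵀ *
          PKLaux g K L j *
          (g.A (N - (j+1)) - g.B (N - (j+1)) * K (N - (j+1)) - g.D (N - (j+1)) * L (N - (j+1)))
        + g.Q (N - (j+1)) + (K (N - (j+1)))ᵀ * g.Ru (N - (j+1)) * K (N - (j+1))
        - (L (N - (j+1)))ᵀ * g.Rw (N - (j+1)) * L (N - (j+1))

/-- Value matrix `P^{K,L}_t`. -/
def PKL (g : LQGame m d n N) (K : ℕ → Matrix (Fin d) (Fin m) ℝ)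
    (L : ℕ → Matrix (Fin n) (Fin m) ℝ) (t : ℕ) : Matrix (Fin m) (Fin m) ℝ :=
  PKLaux g K L (N - t)

/-- Inner-loop Riccati matrices indexed by the number `j` of steps before the terminal
time, i.e. `PKaux g K j = P^K_{N-j}`. -/
def PKaux (g : LQGame m d n N) (K : ℕ → Matrix (Fin d) (Fin m) ℝ) :
    ℕ → Matrix (Fin m) (Fin m) ℝ
  | 0 => g.QN
  | j + 1 =>
      g.Q (N - (j+1)) + (K (N - (j+1)))ᵀ * g.Ru (N - (j+1)) * K (N - (j+1))
        + (g.A (N - (j+1)) - g.B (N - (j+1)) * K (N - (j+1)))ᵀ *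
          (PKaux g K j + PKaux g K j * g.D (N - (j+1)) *
            (g.Rw (N - (j+1)) - (g.D (N - (j+1)))ᵀ * PKaux g K j * g.D (N - (j+1)))⁻¹ *
            (g.D (N - (j+1)))ᵀ * PKaux g K j) *
          (g.A (N - (j+1)) - g.B (N - (j+1)) * K (N - (j+1)))

/-- Inner-loop Riccati matrix `P^K_t`. -/
def PK (g : LQGame m d n N) (K : ℕ → Matrix (Fin d) (Fin m) ℝ) (t : ℕ) :
    Matrix (Fin m) (Fin m) ℝ :=
  PKaux g K (N - t)

/-- `P̃^K_{t+1}`. -/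
def Ptilde (g : LQGame m d n N) (K : ℕ → Matrix (Fin d) (Fin m) ℝ) (t : ℕ) :
    Matrix (Fin m) (Fin m) ℝ :=
  g.PK K (t+1) + g.PK K (t+1) * g.D t *
    (g.Rw t - (g.D t)ᵀ * g.PK K (t+1) * g.D t)⁻¹ * (g.D t)ᵀ * g.PK K (t+1)

/-- `K ∈ 𝒦`. -/
def Admissible (g : LQGame m d n N) (K : ℕ → Matrix (Fin d) (Fin m) ℝ) : Prop :=
  ∀ t < N, (g.Rw t - (g.D t)ᵀ * g.PK K (t+1) * g.D t).PosDef

/-- The inner maximizer `L(K)`. -/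
def Lopt (g : LQGame m d n N) (K : ℕ → Matrix (Fin d) (Fin m) ℝ) (t : ℕ) :
    Matrix (Fin n) (Fin m) ℝ :=
  (-(g.Rw t) + (g.D t)ᵀ * g.PK K (t+1) * g.D t)⁻¹ *
    ((g.D t)ᵀ * g.PK K (t+1) * (g.A t - g.B t * K t))

/-- State covariances `X^{K,L}_t`. -/
def Xcov (g : LQGame m d n N) (K : ℕ → Matrix (Fin d) (Fin m) ℝ)
    (L : ℕ → Matrix (Fin n) (Fin m) ℝ) : ℕ → Matrix (Fin m) (Fin m) ℝ
  | 0 => g.Sig 0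
  | t + 1 =>
      (g.A t - g.B t * K t - g.D t * L t) * Xcov g K L t *
        (g.A t - g.B t * K t - g.D t * L t)ᵀ + g.Sig (t+1)

/-- The game value `G(K,L)`. -/
def value (g : LQGame m d n N) (K : ℕ → Matrix (Fin d) (Fin m) ℝ)
    (L : ℕ → Matrix (Fin n) (Fin m) ℝ) : ℝ :=
  ∑ t ∈ Finset.range (N+1), ((g.PKL K L t) * g.Sig t).trace

/-- `E^{K,L}_t`. -/
def Emat (g : LQGame m d n N) (K : ℕ → Matrix (Fin d) (Fin m) ℝ)
    (L : ℕ → Matrix (Fin n) (Fin m) ℝ) (t : ℕ) : Matrix (Fin n) (Fin m) ℝ :=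
  (-(g.Rw t) + (g.D t)ᵀ * g.PKL K L (t+1) * g.D t) * L t -
    (g.D t)ᵀ * g.PKL K L (t+1) * (g.A t - g.B t * K t)

/-- `H^{K,L}_t`. -/
def Hmat (g : LQGame m d n N) (K : ℕ → Matrix (Fin d) (Fin m) ℝ)
    (L : ℕ → Matrix (Fin n) (Fin m) ℝ) (t : ℕ) : Matrix (Fin n) (Fin n) ℝ :=
  g.Rw t - (g.D t)ᵀ * g.PKL K L (t+1) * g.D t

/-- `F^K_t`. -/
def Fmat (g : LQGame m d n N) (K : ℕ → Matrix (Fin d) (Fin m) ℝ) (t : ℕ) :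
    Matrix (Fin d) (Fin m) ℝ :=
  (g.Ru t + (g.B t)ᵀ * g.Ptilde K t * g.B t) * K t - (g.B t)ᵀ * g.Ptilde K t * g.A t

/-- `G^K_t`. -/
def Gmat (g : LQGame m d n N) (K : ℕ → Matrix (Fin d) (Fin m) ℝ) (t : ℕ) :
    Matrix (Fin d) (Fin d) ℝ :=
  g.Ru t + (g.B t)ᵀ * g.Ptilde K t * g.B t

/-- Game Riccati recursion `P*` indexed by steps before terminal time. -/
def Pstaraux (g : LQGame m d n N) : ℕ → Matrix (Fin m) (Fin m) ℝ
  | 0 => g.QN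
  | j + 1 =>
      g.Q (N - (j+1)) + (g.A (N - (j+1)))ᵀ * Pstaraux g j *
        (1 + (g.B (N - (j+1)) * (g.Ru (N - (j+1)))⁻¹ * (g.B (N - (j+1)))ᵀ
            - g.D (N - (j+1)) * (g.Rw (N - (j+1)))⁻¹ * (g.D (N - (j+1)))ᵀ) * Pstaraux g j)⁻¹ *
        g.A (N - (j+1))

/-- `P*_t`. -/
def Pstar (g : LQGame m d n N) (t : ℕ) : Matrix (Fin m) (Fin m) ℝ :=
  Pstaraux g (N - t)

/-- `Λ_t` of the game Riccati recursion. -/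
def LambdaStar (g : LQGame m d n N) (t : ℕ) : Matrix (Fin m) (Fin m) ℝ :=
  1 + (g.B t * (g.Ru t)⁻¹ * (g.B t)ᵀ - g.D t * (g.Rw t)⁻¹ * (g.D t)ᵀ) * g.Pstar (t+1)

/-- Assumption 2.4. -/
def Assumption24 (g : LQGame m d n N) : Prop :=
  (∀ t < N, IsUnit (g.LambdaStar t)) ∧ (∀ t ≤ N, (g.Pstar t).PosSemidef) ∧
    (∀ t < N, (g.Rw t - (g.D t)ᵀ * g.Pstar (t+1) * g.D t).PosDef)

/-- `φ := min_{0 ≤ t ≤ N} λ_min(Σ⁰_t)`. -/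
def phi (g : LQGame m d n N) : ℝ :=
  (Finset.range (N+1)).inf' (Finset.nonempty_range_iff.mpr (Nat.succ_ne_zero N))
    (fun t => eigMin (g.Sig t))

end LQGame

set_option linter.unusedSectionVars false

section MatrixLemmas

variable {p q r : Type*} [Fintype p] [Fintype q] [Fintype r]

theorem Matrix.PosSemidef.transpose_congr {P : Matrix p p ℝ} (hP : P.PosSemidef)
    (W : Matrix p q ℝ) : (Wᵀ * P * W).PosSemidef := by
  simpa using hP.conjTranspose_mul_mul_same W

theorem Matrix.PosSemidef.transpose_eq {P : Matrix p p ℝ} (hP : P.PosSemidef) : Pᵀ = P := by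
  simpa using hP.isHermitian.eq

theorem Matrix.PosSemidef.of_sub {P P' : Matrix p p ℝ} (h : (P' - P).PosSemidef)
    (hP : P.PosSemidef) : P'.PosSemidef := by
  simpa using h.add hP

theorem Matrix.PosSemidef.sub_trans {P P' P'' : Matrix p p ℝ} (h : (P - P').PosSemidef)
    (h' : (P' - P'').PosSemidef) : (P - P'').PosSemidef := by
  simpa using h.add h'

variable [DecidableEq p] [DecidableEq q] [DecidableEq r]

/-- Weight `P` after the maximizer has played optimally against control cost `R`. -/
def worstCase (D : Matrix p q ℝ) (R : Matrix q q ℝ) (P : Matrix p p ℝ) : Matrix p p ℝ :=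
  P + P * D * (R - Dᵀ * P * D)⁻¹ * Dᵀ * P

/-- Completion of squares in the maximizer's gain. -/
theorem worstCase_eq {D : Matrix p q ℝ} {R : Matrix q q ℝ} {P : Matrix p p ℝ}
    (hP : Pᵀ = P) (hH : (R - Dᵀ * P * D).PosDef) (W : Matrix q p ℝ) :
    worstCase D R P = (1 + D * W)ᵀ * P * (1 + D * W) - Wᵀ * R * W
      + (W - (R - Dᵀ * P * D)⁻¹ * Dᵀ * P)ᵀ * (R - Dᵀ * P * D)
        * (W - (R - Dᵀ * P * D)⁻¹ * Dᵀ * P) := by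
  have hu : IsUnit (R - Dᵀ * P * D).det := (Matrix.isUnit_iff_isUnit_det _).1 hH.isUnit
  have hHt : (R - Dᵀ * P * D)ᵀ = R - Dᵀ * P * D := hH.posSemidef.transpose_eq
  unfold worstCase
  generalize hHdef : R - Dᵀ * P * D = H at *
  obtain rfl : R = H + Dᵀ * P * D := by rw [← hHdef]; abel
  have h1 : ∀ X : Matrix q p ℝ, H * (H⁻¹ * X) = X := fun X => by
    rw [← Matrix.mul_assoc, Matrix.mul_nonsing_inv _ hu, Matrix.one_mul]
  have h2 : ∀ X : Matrix q p ℝ, H⁻¹ * (H * X) = X := fun X => by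
    rw [← Matrix.mul_assoc, Matrix.nonsing_inv_mul _ hu, Matrix.one_mul]
  simp only [Matrix.transpose_add, Matrix.transpose_sub, Matrix.transpose_mul,
    Matrix.transpose_one, Matrix.transpose_transpose, Matrix.transpose_nonsing_inv, hHt, hP,
    Matrix.mul_add, Matrix.add_mul, Matrix.mul_sub, Matrix.sub_mul, Matrix.mul_assoc, h1, h2,
    Matrix.one_mul, Matrix.mul_one]
  abel

theorem worstCase_sub_self {D : Matrix p q ℝ} {R : Matrix q q ℝ} {P : Matrix p p ℝ}
    (hP : P.PosSemidef) (hH : (R - Dᵀ * P * D).PosDef) : (worstCase D R P - P).PosSemidef := by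
  convert hH.inv.posSemidef.transpose_congr (Dᵀ * P) using 1
  simp [worstCase, hP.transpose_eq, Matrix.mul_assoc]

theorem posDef_of_sub_posSemidef {D : Matrix p q ℝ} {R : Matrix q q ℝ} {P P' : Matrix p p ℝ}
    (h : (P' - P).PosSemidef) (hH' : (R - Dᵀ * P' * D).PosDef) :
    (R - Dᵀ * P * D).PosDef := by
  convert hH'.add_posSemidef (h.transpose_congr D) using 1
  simp only [Matrix.mul_sub, Matrix.sub_mul]
  abel

theorem worstCase_mono {D : Matrix p q ℝ} {R : Matrix q q ℝ} {P P' : Matrix p p ℝ}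
    (hP : P.PosSemidef) (hP' : P'.PosSemidef) (h : (P' - P).PosSemidef)
    (hH' : (R - Dᵀ * P' * D).PosDef) : (worstCase D R P' - worstCase D R P).PosSemidef := by
  have hH := posDef_of_sub_posSemidef h hH'
  have e := worstCase_eq hP.transpose_eq hH ((R - Dᵀ * P * D)⁻¹ * Dᵀ * P)
  have e' := worstCase_eq hP'.transpose_eq hH' ((R - Dᵀ * P * D)⁻¹ * Dᵀ * P)
  rw [e, e']
  generalize (R - Dᵀ * P * D)⁻¹ * Dᵀ * P = W
  convert (h.transpose_congr (1 + D * W)).add (hH'.posSemidef.transpose_congr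
    (W - (R - Dᵀ * P' * D)⁻¹ * Dᵀ * P')) using 1
  simp only [sub_self, Matrix.transpose_zero, Matrix.zero_mul, add_zero,
    Matrix.sub_mul _ _ (1 + D * W), Matrix.mul_sub _ P' P]
  abel

/-- One-step cost of the minimizer's gain `K` against the continuation weight `T`. -/
def stepCost (A : Matrix p p ℝ) (B : Matrix p r ℝ) (Q : Matrix p p ℝ) (R : Matrix r r ℝ)
    (K : Matrix r p ℝ) (T : Matrix p p ℝ) : Matrix p p ℝ :=
  Q + Kᵀ * R * K + (A - B * K)ᵀ * T * (A - B * K)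

theorem stepCost_posSemidef {A : Matrix p p ℝ} {B : Matrix p r ℝ} {Q : Matrix p p ℝ}
    {R : Matrix r r ℝ} (K : Matrix r p ℝ) {T : Matrix p p ℝ} (hQ : Q.PosSemidef)
    (hR : R.PosSemidef) (hT : T.PosSemidef) : (stepCost A B Q R K T).PosSemidef :=
  (hQ.add (hR.transpose_congr K)).add (hT.transpose_congr _)

theorem stepCost_mono {A : Matrix p p ℝ} {B : Matrix p r ℝ} {Q : Matrix p p ℝ}
    {R : Matrix r r ℝ} (K : Matrix r p ℝ) {T T' : Matrix p p ℝ} (h : (T' - T).PosSemidef) :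
    (stepCost A B Q R K T' - stepCost A B Q R K T).PosSemidef := by
  convert h.transpose_congr (A - B * K) using 1
  rw [Matrix.mul_sub _ T' T, Matrix.sub_mul _ _ (A - B * K)]
  simp [stepCost]

/-- Exact second-order expansion of the one-step cost in the gain. -/
theorem stepCost_sub_gain {A : Matrix p p ℝ} {B : Matrix p r ℝ} {Q : Matrix p p ℝ}
    {R : Matrix r r ℝ} (K E : Matrix r p ℝ) {T : Matrix p p ℝ} (hR : Rᵀ = R) (hT : Tᵀ = T) :
    stepCost A B Q R (K - E) T = stepCost A B Q R K T
      - Eᵀ * ((R + Bᵀ * T * B) * K - Bᵀ * T * A) - ((R + Bᵀ * T * B) * K - Bᵀ * T * A)ᵀ * E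
      + Eᵀ * (R + Bᵀ * T * B) * E := by
  simp only [stepCost, Matrix.transpose_add, Matrix.transpose_sub, Matrix.transpose_mul,
    Matrix.transpose_transpose, hR, hT,
    Matrix.mul_add, Matrix.add_mul, Matrix.mul_sub, Matrix.sub_mul, Matrix.mul_assoc]
  abel

theorem stepCost_gaussNewton {A : Matrix p p ℝ} {B : Matrix p r ℝ} {Q : Matrix p p ℝ}
    {R : Matrix r r ℝ} (K : Matrix r p ℝ) {T : Matrix p p ℝ} (hR : R.PosDef)
    (hT : T.PosSemidef) {F : Matrix r p ℝ} (hF : F = (R + Bᵀ * T * B) * K - Bᵀ * T * A) (α : ℝ) :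
    stepCost A B Q R K T - stepCost A B Q R (K - (2 * α) • ((R + Bᵀ * T * B)⁻¹ * F)) T
      = (4 * α * (1 - α)) • (Fᵀ * (R + Bᵀ * T * B)⁻¹ * F) := by
  rw [stepCost_sub_gain _ _ hR.posSemidef.transpose_eq hT.transpose_eq, ← hF]
  have hG : (R + Bᵀ * T * B).PosDef := hR.add_posSemidef (hT.transpose_congr B)
  have hu : IsUnit (R + Bᵀ * T * B).det := (Matrix.isUnit_iff_isUnit_det _).1 hG.isUnit
  have hGt := hG.posSemidef.transpose_eq
  clear hF
  generalize R + Bᵀ * T * B = G at *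
  have h1 : G * (G⁻¹ * F) = F := by
    rw [← Matrix.mul_assoc, Matrix.mul_nonsing_inv _ hu, Matrix.one_mul]
  simp only [Matrix.transpose_smul, Matrix.transpose_mul, Matrix.transpose_nonsing_inv, hGt,
    Matrix.smul_mul, Matrix.mul_smul, Matrix.mul_assoc, h1]
  module

/-- The minimal one-step cost against `worstCase` is given by the game Riccati map. -/
theorem stepCost_sub_riccati {A : Matrix p p ℝ} {B : Matrix p r ℝ} {D : Matrix p q ℝ}
    {Q : Matrix p p ℝ} {R : Matrix r r ℝ} {Rw : Matrix q q ℝ} (K : Matrix r p ℝ)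
    {P : Matrix p p ℝ} (hR : R.PosDef) (hRw : Rw.PosDef) (hP : P.PosSemidef)
    (hH : (Rw - Dᵀ * P * D).PosDef)
    (hL : IsUnit (1 + (B * R⁻¹ * Bᵀ - D * Rw⁻¹ * Dᵀ) * P)) :
    (stepCost A B Q R K (worstCase D Rw P)
      - (Q + Aᵀ * P * (1 + (B * R⁻¹ * Bᵀ - D * Rw⁻¹ * Dᵀ) * P)⁻¹ * A)).PosSemidef := by
  have hT : (worstCase D Rw P).PosSemidef := (worstCase_sub_self hP hH).of_sub hP
  have hTt := hT.transpose_eq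
  have huR : IsUnit R.det := (Matrix.isUnit_iff_isUnit_det _).1 hR.isUnit
  have huRw : IsUnit Rw.det := (Matrix.isUnit_iff_isUnit_det _).1 hRw.isUnit
  have huH : IsUnit (Rw - Dᵀ * P * D).det := (Matrix.isUnit_iff_isUnit_det _).1 hH.isUnit
  have huL := (Matrix.isUnit_iff_isUnit_det _).1 hL
  have hG : (R + Bᵀ * worstCase D Rw P * B).PosDef := hR.add_posSemidef (hT.transpose_congr B)
  have hTP : worstCase D Rw P * (1 - D * Rw⁻¹ * Dᵀ * P) = P := by
    have h_resolvent : (Rw - Dᵀ * P * D)⁻¹ * (Dᵀ * P * D) * Rw⁻¹ = (Rw - Dᵀ * P * D)⁻¹ - Rw⁻¹ := by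
      calc (Rw - Dᵀ * P * D)⁻¹ * (Dᵀ * P * D) * Rw⁻¹
          = (Rw - Dᵀ * P * D)⁻¹ * (Rw - (Rw - Dᵀ * P * D)) * Rw⁻¹ := by rw [sub_sub_cancel]
        _ = _ := by
          rw [Matrix.mul_sub _ Rw, Matrix.sub_mul, Matrix.nonsing_inv_mul _ huH,
            Matrix.mul_assoc, Matrix.mul_nonsing_inv _ huRw, Matrix.mul_one, Matrix.one_mul]
    have h_expand : worstCase D Rw P * (1 - D * Rw⁻¹ * Dᵀ * P) = P + P * D * ((Rw - Dᵀ * P * D)⁻¹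
        - Rw⁻¹ - (Rw - Dᵀ * P * D)⁻¹ * (Dᵀ * P * D) * Rw⁻¹) * Dᵀ * P := by
      unfold worstCase
      generalize (Rw - Dᵀ * P * D)⁻¹ = J
      simp only [Matrix.add_mul, Matrix.mul_sub, Matrix.sub_mul, Matrix.mul_assoc,
        Matrix.mul_one]
      abel
    rw [h_expand, h_resolvent]
    simp
  obtain ⟨S, hS⟩ : ∃ S, S = (1 + (B * R⁻¹ * Bᵀ - D * Rw⁻¹ * Dᵀ) * P)⁻¹ * A := ⟨_, rfl⟩
  have hLS : S + B * (R⁻¹ * Bᵀ * P * S) - D * Rw⁻¹ * Dᵀ * P * S = A := by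
    have : (1 + (B * R⁻¹ * Bᵀ - D * Rw⁻¹ * Dᵀ) * P) * S = A := by
      rw [hS, ← Matrix.mul_assoc, Matrix.mul_nonsing_inv _ huL, Matrix.one_mul]
    rw [← this]
    simp only [Matrix.add_mul, Matrix.sub_mul, Matrix.mul_assoc, Matrix.one_mul]
    abel
  obtain ⟨K', hK'⟩ : ∃ K', K' = R⁻¹ * Bᵀ * P * S := ⟨_, rfl⟩
  rw [← hK'] at hLS
  have hcl : worstCase D Rw P * (A - B * K') = P * S := by
    have hAS : A - B * K' = (1 - D * Rw⁻¹ * Dᵀ * P) * S := by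
      rw [Matrix.sub_mul, Matrix.one_mul, ← hLS]
      abel
    rw [hAS, ← Matrix.mul_assoc, hTP]
  have hRK : R * K' = Bᵀ * P * S := by
    rw [hK', Matrix.mul_assoc R⁻¹, Matrix.mul_assoc R⁻¹, ← Matrix.mul_assoc R,
      Matrix.mul_nonsing_inv _ huR, Matrix.one_mul]
  have hF : (R + Bᵀ * worstCase D Rw P * B) * K' - Bᵀ * worstCase D Rw P * A = 0 := by
    have : (R + Bᵀ * worstCase D Rw P * B) * K' - Bᵀ * worstCase D Rw P * A
        = R * K' - Bᵀ * (worstCase D Rw P * (A - B * K')) := by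
      simp only [Matrix.add_mul, Matrix.mul_sub, Matrix.mul_assoc]
      abel
    rw [this, hcl, hRK, Matrix.mul_assoc, sub_self]
  have hval : stepCost A B Q R K' (worstCase D Rw P) = Q + Aᵀ * P * S := by
    rw [stepCost, Matrix.mul_assoc _ (worstCase D Rw P), hcl, Matrix.mul_assoc, hRK]
    simp only [Matrix.transpose_sub, Matrix.transpose_mul, Matrix.sub_mul, Matrix.mul_assoc]
    abel
  have hexp := stepCost_sub_gain (A := A) (B := B) (Q := Q) K' (K' - K)
    hR.posSemidef.transpose_eq hTt
  rw [sub_sub_cancel, hF, hval] at hexp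
  rw [hexp, Matrix.mul_assoc _ _ A, ← hS]
  simpa using hG.posSemidef.transpose_congr (K' - K)

open scoped MatrixOrder in
theorem Matrix.PosSemidef.trace_mul_nonneg_of_posSemidef {X Y : Matrix p p ℝ}
    (hX : X.PosSemidef) (hY : Y.PosSemidef) : 0 ≤ (X * Y).trace := by
  obtain ⟨Z, rfl⟩ := CStarAlgebra.nonneg_iff_eq_star_mul_self.1 hY.nonneg
  rw [Matrix.star_eq_conjTranspose]
  rw [← Matrix.mul_assoc, Matrix.trace_mul_comm, ← Matrix.mul_assoc]
  exact (hX.mul_mul_conjTranspose_same Z).trace_nonneg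

theorem Matrix.PosDef.inv_sub_smul_one {G : Matrix p p ℝ} (hG : G.PosDef) {c : ℝ} (hc : 0 < c)
    (h : (c • (1 : Matrix p p ℝ) - G).PosSemidef) :
    (G⁻¹ - c⁻¹ • (1 : Matrix p p ℝ)).PosSemidef := by
  have hu : IsUnit G.det := (Matrix.isUnit_iff_isUnit_det _).1 hG.isUnit
  have hGt := hG.posSemidef.transpose_eq
  convert (hG.posSemidef.transpose_congr (G⁻¹ - c⁻¹ • (1 : Matrix p p ℝ))).add
    (h.smul (by positivity : 0 ≤ c⁻¹ * c⁻¹)) using 1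
  simp only [Matrix.transpose_sub, Matrix.transpose_smul, Matrix.transpose_nonsing_inv, hGt,
    Matrix.transpose_one, Matrix.sub_mul, Matrix.mul_sub, Matrix.smul_mul, Matrix.mul_smul,
    Matrix.nonsing_inv_mul _ hu, Matrix.mul_nonsing_inv _ hu, Matrix.one_mul, Matrix.mul_one,
    smul_sub, smul_smul]
  rw [mul_assoc, inv_mul_cancel₀ hc.ne', mul_one]
  abel

end MatrixLemmas

section Rayleigh

variable {a : ℕ}

theorem abs_le_one_of_dotProduct_self {x : Fin a → ℝ} (hx : x ⬝ᵥ x = 1) (i : Fin a) :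
    |x i| ≤ 1 := by
  rw [← sq_le_one_iff_abs_le_one, ← hx, dotProduct, sq]
  exact Finset.single_le_sum (f := fun i => x i * x i) (fun j _ => mul_self_nonneg (x j))
    (Finset.mem_univ i)

theorem rayleighSet_bddAbove (M : Matrix (Fin a) (Fin a) ℝ) : BddAbove (rayleighSet M) := by
  refine ⟨∑ i, ∑ j, |M i j|, ?_⟩
  rintro _ ⟨x, hx, rfl⟩
  simp only [dotProduct, Matrix.mulVec, Finset.mul_sum]
  refine Finset.sum_le_sum fun i _ => Finset.sum_le_sum fun j _ => ?_
  calc x i * (M i j * x j) ≤ |x i * (M i j * x j)| := le_abs_self _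
    _ = |x i| * |M i j| * |x j| := by rw [abs_mul, abs_mul, mul_assoc]
    _ ≤ 1 * |M i j| * 1 := by
      gcongr
      · exact abs_le_one_of_dotProduct_self hx i
      · exact abs_le_one_of_dotProduct_self hx j
    _ = |M i j| := by ring

/-- A quadratic form that is nonnegative on the unit sphere is nonnegative. -/
theorem Matrix.IsHermitian.posSemidef_of_unit {M : Matrix (Fin a) (Fin a) ℝ}
    (hM : M.IsHermitian) (h : ∀ x : Fin a → ℝ, x ⬝ᵥ x = 1 → 0 ≤ x ⬝ᵥ M *ᵥ x) :
    M.PosSemidef := by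
  refine .of_dotProduct_mulVec_nonneg hM fun x => ?_
  rw [star_trivial]
  rcases eq_or_ne x 0 with rfl | hx
  · simp
  have hpos : 0 < x ⬝ᵥ x := by
    simpa using Matrix.dotProduct_star_self_pos_iff.2 hx
  have hs : √(x ⬝ᵥ x) * √(x ⬝ᵥ x) = x ⬝ᵥ x := Real.mul_self_sqrt hpos.le
  have hs0 : √(x ⬝ᵥ x) ≠ 0 := (Real.sqrt_pos.2 hpos).ne'
  have hu := h ((√(x ⬝ᵥ x))⁻¹ • x) (by
    rw [smul_dotProduct, dotProduct_smul, smul_eq_mul, smul_eq_mul, ← mul_assoc, ← mul_inv, hs,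
      inv_mul_cancel₀ hpos.ne'])
  rw [Matrix.mulVec_smul, smul_dotProduct, dotProduct_smul, smul_eq_mul, smul_eq_mul, ← mul_assoc,
    ← mul_inv, hs] at hu
  exact nonneg_of_mul_nonneg_right hu (inv_pos.2 hpos)

theorem isHermitian_smul_one (c : ℝ) : (c • (1 : Matrix (Fin a) (Fin a) ℝ)).IsHermitian := by
  simp [Matrix.IsHermitian]

theorem dotProduct_mulVec_le_opNorm (M : Matrix (Fin a) (Fin a) ℝ) {x : Fin a → ℝ}
    (hx : x ⬝ᵥ x = 1) : x ⬝ᵥ M *ᵥ x ≤ opNorm M := by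
  refine Real.le_sqrt_of_sq_le ?_
  calc (x ⬝ᵥ M *ᵥ x) ^ 2 ≤ (x ⬝ᵥ x) * (M *ᵥ x ⬝ᵥ M *ᵥ x) := by
        simpa only [dotProduct, ← sq] using
          Finset.sum_mul_sq_le_sq_mul_sq Finset.univ x (M *ᵥ x)
    _ = x ⬝ᵥ (Mᵀ * M) *ᵥ x := by
        rw [hx, one_mul, ← Matrix.mulVec_mulVec, Matrix.dotProduct_mulVec x,
          Matrix.vecMul_transpose]
    _ ≤ eigMax (Mᵀ * M) := le_csSup (rayleighSet_bddAbove _) ⟨x, hx, rfl⟩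

theorem opNorm_smul_one_sub {M : Matrix (Fin a) (Fin a) ℝ} (hM : M.IsHermitian) :
    (opNorm M • (1 : Matrix (Fin a) (Fin a) ℝ) - M).PosSemidef := by
  refine ((isHermitian_smul_one _).sub hM).posSemidef_of_unit fun x hx => ?_
  rw [Matrix.sub_mulVec, Matrix.smul_mulVec, Matrix.one_mulVec, dotProduct_sub, dotProduct_smul,
    hx, smul_eq_mul, mul_one]
  exact sub_nonneg.2 (dotProduct_mulVec_le_opNorm M hx)

theorem dotProduct_self_single (i : Fin a) :
    (Pi.single i 1 : Fin a → ℝ) ⬝ᵥ Pi.single i 1 = 1 := by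
  simp

theorem opNorm_pos [Nonempty (Fin a)] {M : Matrix (Fin a) (Fin a) ℝ} (hM : M.PosDef) :
    0 < opNorm M := by
  obtain ⟨i⟩ := ‹Nonempty (Fin a)›
  refine lt_of_lt_of_le ?_ (dotProduct_mulVec_le_opNorm M (dotProduct_self_single i))
  simpa using hM.diag_pos (i := i)

theorem sub_eigMin_smul_one {M : Matrix (Fin a) (Fin a) ℝ} (hM : M.PosSemidef) {c : ℝ}
    (hc : c ≤ eigMin M) : (M - c • (1 : Matrix (Fin a) (Fin a) ℝ)).PosSemidef := by
  refine (hM.isHermitian.sub (isHermitian_smul_one _)).posSemidef_of_unit fun x hx => ?_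
  rw [Matrix.sub_mulVec, Matrix.smul_mulVec, Matrix.one_mulVec, dotProduct_sub, dotProduct_smul,
    hx, smul_eq_mul, mul_one, sub_nonneg]
  refine hc.trans (csInf_le ⟨0, ?_⟩ ⟨x, hx, rfl⟩)
  rintro _ ⟨y, -, rfl⟩
  simpa using hM.dotProduct_mulVec_nonneg y

theorem eigMin_pos [Nonempty (Fin a)] {M : Matrix (Fin a) (Fin a) ℝ} (hM : M.PosDef) :
    0 < eigMin M := by
  have hc := opNorm_pos hM.inv
  refine lt_of_lt_of_le (inv_pos.2 hc) (le_csInf ?_ ?_)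
  · obtain ⟨i⟩ := ‹Nonempty (Fin a)›
    exact ⟨_, _, dotProduct_self_single i, rfl⟩
  · rintro _ ⟨x, hx, rfl⟩
    have h := (hM.inv.inv_sub_smul_one hc
      (opNorm_smul_one_sub hM.inv.isHermitian)).dotProduct_mulVec_nonneg x
    rw [Matrix.nonsing_inv_nonsing_inv _ ((Matrix.isUnit_iff_isUnit_det _).1 hM.isUnit),
      star_trivial, Matrix.sub_mulVec, Matrix.smul_mulVec, Matrix.one_mulVec, dotProduct_sub,
      dotProduct_smul, hx, smul_eq_mul, mul_one, sub_nonneg] at h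
    exact h

theorem frobNormSq_eq_trace {b : ℕ} (M : Matrix (Fin a) (Fin b) ℝ) :
    frobNormSq M = (Mᵀ * M).trace := by
  rw [frobNormSq, Finset.sum_comm]
  simp [Matrix.trace, Matrix.mul_apply, sq]

theorem frobNormSq_le_trace {b : ℕ} {F : Matrix (Fin a) (Fin b) ℝ} {G : Matrix (Fin a) (Fin a) ℝ}
    {S : Matrix (Fin b) (Fin b) ℝ} (hG : G.PosDef) {c φ : ℝ} (hc : 0 < c) (hφ : 0 ≤ φ)
    (hGc : (c • (1 : Matrix (Fin a) (Fin a) ℝ) - G).PosSemidef)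
    (hS : (S - φ • (1 : Matrix (Fin b) (Fin b) ℝ)).PosSemidef) :
    φ * frobNormSq F ≤ c * (Fᵀ * G⁻¹ * F * S).trace := by
  have h1 := (hG.inv.posSemidef.transpose_congr F).trace_mul_nonneg_of_posSemidef hS
  have h2 := ((hG.inv_sub_smul_one hc hGc).transpose_congr F).trace_nonneg
  simp only [Matrix.mul_sub, Matrix.sub_mul, Matrix.trace_sub, Matrix.mul_smul, Matrix.smul_mul,
    Matrix.mul_one, Matrix.trace_smul, smul_eq_mul, sub_nonneg] at h1 h2
  rw [← frobNormSq_eq_trace, inv_mul_le_iff₀ hc] at h2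
  calc φ * frobNormSq F ≤ φ * (c * (Fᵀ * G⁻¹ * F).trace) := by gcongr
    _ = c * (φ * (Fᵀ * G⁻¹ * F).trace) := by ring
    _ ≤ _ := by gcongr

end Rayleigh

namespace LQGame

variable {m d n N : ℕ} (g : LQGame m d n N)

theorem Ptilde_eq_worstCase (K : ℕ → Matrix (Fin d) (Fin m) ℝ) (t : ℕ) :
    g.Ptilde K t = worstCase (g.D t) (g.Rw t) (g.PK K (t + 1)) := rfl

theorem PK_of_le (K : ℕ → Matrix (Fin d) (Fin m) ℝ) {t : ℕ} (ht : N ≤ t) :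
    g.PK K t = g.QN := by
  rw [PK, Nat.sub_eq_zero_of_le ht, PKaux]

theorem Pstar_of_le {t : ℕ} (ht : N ≤ t) : g.Pstar t = g.QN := by
  rw [Pstar, Nat.sub_eq_zero_of_le ht, Pstaraux]

theorem PK_of_lt (K : ℕ → Matrix (Fin d) (Fin m) ℝ) {t : ℕ} (ht : t < N) :
    g.PK K t = stepCost (g.A t) (g.B t) (g.Q t) (g.Ru t) (K t) (g.Ptilde K t) := by
  have h1 : N - t = N - (t + 1) + 1 := by omega
  have h2 : N - (N - (t + 1) + 1) = t := by omega
  rw [PK, h1, PKaux, h2]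
  rfl

theorem Pstar_of_lt {t : ℕ} (ht : t < N) :
    g.Pstar t = g.Q t + (g.A t)ᵀ * g.Pstar (t + 1) * (g.LambdaStar t)⁻¹ * g.A t := by
  have h1 : N - t = N - (t + 1) + 1 := by omega
  have h2 : N - (N - (t + 1) + 1) = t := by omega
  rw [Pstar, h1, Pstaraux, h2]
  rfl

/-- Backward induction on time from the horizon. -/
theorem backward_induction {p : ℕ → Prop} (hN : p N) (hstep : ∀ t < N, p (t + 1) → p t) :
    ∀ t ≤ N, p t := fun _ ht =>
  Nat.decreasingInduction (motive := fun k _ => p k) (fun k hk ih => hstep k hk ih) hN ht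

variable {g} {K K' : ℕ → Matrix (Fin d) (Fin m) ℝ}

theorem Admissible.PK_posSemidef (hK : g.Admissible K) :
    ∀ t ≤ N, (g.PK K t).PosSemidef := by
  refine backward_induction (by rw [g.PK_of_le K le_rfl]; exact g.hQN) fun t ht ih => ?_
  rw [g.PK_of_lt K ht]
  exact stepCost_posSemidef _ (g.hQ t ht) (g.hRu t ht).posSemidef
    ((worstCase_sub_self ih (hK t ht)).of_sub ih)

theorem Admissible.Ptilde_posSemidef (hK : g.Admissible K) {t : ℕ} (ht : t < N) :
    (g.Ptilde K t).PosSemidef :=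
  have h := hK.PK_posSemidef (t + 1) ht
  (worstCase_sub_self h (hK t ht)).of_sub h

theorem Admissible.Gmat_posDef (hK : g.Admissible K) {t : ℕ} (ht : t < N) :
    (g.Gmat K t).PosDef :=
  (g.hRu t ht).add_posSemidef ((hK.Ptilde_posSemidef ht).transpose_congr _)

theorem Admissible.sub_Pstar_posSemidef (hK : g.Admissible K) (hA : g.Assumption24) :
    ∀ t ≤ N, (g.PK K t - g.Pstar t).PosSemidef := by
  obtain ⟨hL, hP, hH⟩ := hA
  refine backward_induction ?_ fun t ht ih => ?_
  · rw [g.PK_of_le K le_rfl, g.Pstar_of_le le_rfl, sub_self]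
    exact .zero
  · rw [g.PK_of_lt K ht, g.Pstar_of_lt ht]
    exact (stepCost_mono (K t) (worstCase_mono (hP _ ht) (hK.PK_posSemidef _ ht) ih
      (hK t ht))).sub_trans
      (stepCost_sub_riccati (K t) (g.hRu t ht) (g.hRw t ht) (hP _ ht) (hH t ht) (hL t ht))

/-- `K'` is a Gauss–Newton update of `K` with step size `2 * α`. -/
def IsGaussNewtonStep (g : LQGame m d n N) (α : ℝ) (K K' : ℕ → Matrix (Fin d) (Fin m) ℝ) : Prop :=
  ∀ t < N, K' t = K t - (2 * α) • ((g.Gmat K t)⁻¹ * g.Fmat K t)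

namespace IsGaussNewtonStep

variable {α : ℝ}

theorem decrease_of_succ (h : g.IsGaussNewtonStep α K K') (hα0 : 0 < α) (hα : α ≤ 1 / 2)
    (hK : g.Admissible K) {t : ℕ} (ht : t < N) (hP' : (g.PK K' (t + 1)).PosSemidef)
    (hsub : (g.PK K (t + 1) - g.PK K' (t + 1)).PosSemidef) :
    (g.PK K t - g.PK K' t
      - (2 * α) • ((g.Fmat K t)ᵀ * (g.Gmat K t)⁻¹ * g.Fmat K t)).PosSemidef := by
  have hmono := stepCost_mono (A := g.A t) (B := g.B t) (Q := g.Q t) (R := g.Ru t) (K' t)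
    (worstCase_mono hP' (hK.PK_posSemidef _ ht) hsub (hK t ht))
  rw [← Ptilde_eq_worstCase, ← Ptilde_eq_worstCase, ← g.PK_of_lt K' ht] at hmono
  have hgn : g.PK K t - stepCost (g.A t) (g.B t) (g.Q t) (g.Ru t) (K' t) (g.Ptilde K t)
      = (4 * α * (1 - α)) • ((g.Fmat K t)ᵀ * (g.Gmat K t)⁻¹ * g.Fmat K t) := by
    rw [h t ht, g.PK_of_lt K ht]
    exact stepCost_gaussNewton (K t) (g.hRu t ht) (hK.Ptilde_posSemidef ht) rfl α
  have hX := ((hK.Gmat_posDef ht).inv.posSemidef.transpose_congr (g.Fmat K t)).smul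
    (by nlinarith : 0 ≤ 4 * α * (1 - α) - 2 * α)
  convert hmono.add hX using 1
  rw [sub_smul, ← hgn]
  abel

theorem posSemidef_sub (h : g.IsGaussNewtonStep α K K') (hα0 : 0 < α) (hα : α ≤ 1 / 2)
    (hK : g.Admissible K) :
    ∀ t ≤ N, (g.PK K' t).PosSemidef ∧ (g.PK K t - g.PK K' t).PosSemidef := by
  refine backward_induction ?_ fun t ht ih => ⟨?_, ?_⟩
  · rw [g.PK_of_le K le_rfl, g.PK_of_le K' le_rfl, sub_self]
    exact ⟨g.hQN, .zero⟩
  · rw [g.PK_of_lt K' ht]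
    have hH' := posDef_of_sub_posSemidef ih.2 (hK t ht)
    exact stepCost_posSemidef _ (g.hQ t ht) (g.hRu t ht).posSemidef
      ((worstCase_sub_self ih.1 hH').of_sub ih.1)
  · exact (h.decrease_of_succ hα0 hα hK ht ih.1 ih.2).of_sub
      (((hK.Gmat_posDef ht).inv.posSemidef.transpose_congr (g.Fmat K t)).smul (by positivity))

theorem admissible (h : g.IsGaussNewtonStep α K K') (hα0 : 0 < α) (hα : α ≤ 1 / 2)
    (hK : g.Admissible K) : g.Admissible K' := fun t ht =>
  posDef_of_sub_posSemidef (h.posSemidef_sub hα0 hα hK (t + 1) ht).2 (hK t ht)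

theorem decrease (h : g.IsGaussNewtonStep α K K') (hα0 : 0 < α) (hα : α ≤ 1 / 2)
    (hK : g.Admissible K) {t : ℕ} (ht : t < N) :
    (g.PK K t - g.PK K' t
      - (2 * α) • ((g.Fmat K t)ᵀ * (g.Gmat K t)⁻¹ * g.Fmat K t)).PosSemidef :=
  have hs := h.posSemidef_sub hα0 hα hK (t + 1) ht
  h.decrease_of_succ hα0 hα hK ht hs.1 hs.2

theorem Gmat_sub (h : g.IsGaussNewtonStep α K K') (hα0 : 0 < α) (hα : α ≤ 1 / 2)
    (hK : g.Admissible K) {t : ℕ} (ht : t < N) : (g.Gmat K t - g.Gmat K' t).PosSemidef := by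
  have hs := h.posSemidef_sub hα0 hα hK (t + 1) ht
  convert (worstCase_mono hs.1 (hK.PK_posSemidef _ ht) hs.2 (hK t ht)).transpose_congr (g.B t)
    using 1
  rw [Matrix.mul_sub, Matrix.sub_mul, Gmat, Gmat, add_sub_add_left_eq_sub]
  rfl

end IsGaussNewtonStep

theorem phi_le_eigMin (g : LQGame m d n N) {t : ℕ} (ht : t ≤ N) : g.phi ≤ eigMin (g.Sig t) :=
  Finset.inf'_le (fun t => eigMin (g.Sig t)) (Finset.mem_range.2 (Nat.lt_succ_of_le ht))

theorem phi_pos [Nonempty (Fin m)] (g : LQGame m d n N) : 0 < g.phi :=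
  (Finset.lt_inf'_iff _).2 fun t ht =>
    eigMin_pos (g.hSig t (Nat.le_of_lt_succ (Finset.mem_range.1 ht)))

/-- The summed cost `∑ t, Tr (P^K_t Σ_t)`. -/
def totalCost (g : LQGame m d n N) (K : ℕ → Matrix (Fin d) (Fin m) ℝ) : ℝ :=
  ∑ t ∈ Finset.range (N + 1), (g.PK K t * g.Sig t).trace

/-- One Gauss–Newton step decreases the summed cost by at least a multiple of `∑ t, ‖F_t‖²`. -/
theorem IsGaussNewtonStep.sum_frobNormSq_le {α : ℝ} (h : g.IsGaussNewtonStep α K K')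
    (hα0 : 0 < α) (hα : α ≤ 1 / 2) (hK : g.Admissible K) {c : ℝ} (hc : 0 < c) (hφ : 0 ≤ g.phi)
    (hGc : ∀ t < N, (c • (1 : Matrix (Fin d) (Fin d) ℝ) - g.Gmat K t).PosSemidef) :
    2 * α * g.phi * ∑ t ∈ Finset.range N, frobNormSq (g.Fmat K t)
      ≤ c * (g.totalCost K - g.totalCost K') := by
  have hN : g.totalCost K - g.totalCost K'
      = ∑ t ∈ Finset.range N, ((g.PK K t - g.PK K' t) * g.Sig t).trace := by
    simp only [totalCost, Finset.sum_range_succ, g.PK_of_le _ le_rfl, add_sub_add_right_eq_sub,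
      ← Finset.sum_sub_distrib, Matrix.sub_mul, Matrix.trace_sub]
  rw [hN, Finset.mul_sum, Finset.mul_sum]
  refine Finset.sum_le_sum fun t ht => ?_
  rw [Finset.mem_range] at ht
  have hd := (h.decrease hα0 hα hK ht).trace_mul_nonneg_of_posSemidef (g.hSig t ht.le).posSemidef
  have hF := frobNormSq_le_trace (F := g.Fmat K t) (hK.Gmat_posDef ht) hc hφ (hGc t ht)
    (sub_eigMin_smul_one (g.hSig t ht.le).posSemidef (g.phi_le_eigMin ht.le))
  rw [Matrix.sub_mul, Matrix.trace_sub, Matrix.smul_mul, Matrix.trace_smul, smul_eq_mul,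
    sub_nonneg] at hd
  calc 2 * α * g.phi * frobNormSq (g.Fmat K t)
      = 2 * α * (g.phi * frobNormSq (g.Fmat K t)) := by ring
    _ ≤ 2 * α * (c * ((g.Fmat K t)ᵀ * (g.Gmat K t)⁻¹ * g.Fmat K t * g.Sig t).trace) := by gcongr
    _ = c * (2 * α * ((g.Fmat K t)ᵀ * (g.Gmat K t)⁻¹ * g.Fmat K t * g.Sig t).trace) := by ring
    _ ≤ _ := by gcongr

end LQGame

/-- outer-loop global convergence of Gauss–Newton. -/
theorem LQGame.gaussNewton_outer_convergence {m d n N : ℕ} (g : LQGame m d n N)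
    (hN : 0 < N) (hA : g.Assumption24)
    (K0 : ℕ → Matrix (Fin d) (Fin m) ℝ) (hK0 : g.Admissible K0)
    (α : ℝ) (hα0 : 0 < α) (hα : α ≤ 1 / 2)
    (Kseq : ℕ → ℕ → Matrix (Fin d) (Fin m) ℝ) (hinit : Kseq 0 = K0)
    (hstep : ∀ k : ℕ, ∀ t < N,
      Kseq (k+1) t = Kseq k t - (2 * α) • ((g.Gmat (Kseq k) t)⁻¹ * g.Fmat (Kseq k) t)) :
    ∀ M : ℕ, 0 < M →
      (1 / (M : ℝ)) * ∑ k ∈ Finset.range M, ∑ t ∈ Finset.range N, frobNormSq (g.Fmat (Kseq k) t)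
        ≤ ((Finset.range N).sup' (Finset.nonempty_range_iff.mpr hN.ne')
              (fun t => opNorm (g.Gmat K0 t)) *
            ∑ t ∈ Finset.range (N+1), ((g.PK K0 t - g.Pstar t) * g.Sig t).trace)
          / (2 * α * g.phi * M) := by
  intro M hM
  set c := (Finset.range N).sup' (Finset.nonempty_range_iff.mpr hN.ne')
    (fun t => opNorm (g.Gmat K0 t))
  have hcle : ∀ t < N, opNorm (g.Gmat K0 t) ≤ c := fun t ht =>
    Finset.le_sup' (fun t => opNorm (g.Gmat K0 t)) (Finset.mem_range.2 ht)
  have hiter : ∀ k, g.Admissible (Kseq k) ∧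
      ∀ t < N, (g.Gmat K0 t - g.Gmat (Kseq k) t).PosSemidef := by
    intro k
    induction k with
    | zero =>
      rw [hinit]
      exact ⟨hK0, fun t _ => by rw [sub_self]; exact .zero⟩
    | succ k ih =>
      have hs : g.IsGaussNewtonStep α (Kseq k) (Kseq (k + 1)) := hstep k
      exact ⟨hs.admissible hα0 hα ih.1,
        fun t ht => (ih.2 t ht).sub_trans (hs.Gmat_sub hα0 hα ih.1 ht)⟩
  have hgap : ∀ k, 0 ≤ g.totalCost (Kseq k)
      - ∑ t ∈ Finset.range (N + 1), (g.Pstar t * g.Sig t).trace := by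
    intro k
    rw [totalCost, ← Finset.sum_sub_distrib]
    refine Finset.sum_nonneg fun t ht => ?_
    have ht' := Nat.le_of_lt_succ (Finset.mem_range.1 ht)
    rw [← Matrix.trace_sub, ← Matrix.sub_mul]
    exact ((hiter k).1.sub_Pstar_posSemidef hA t ht').trace_mul_nonneg_of_posSemidef
      (g.hSig t ht').posSemidef
  have hsum : ∑ t ∈ Finset.range (N + 1), ((g.PK K0 t - g.Pstar t) * g.Sig t).trace
      = g.totalCost (Kseq 0) - ∑ t ∈ Finset.range (N + 1), (g.Pstar t * g.Sig t).trace := by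
    simp only [totalCost, hinit, Matrix.sub_mul, Matrix.trace_sub, Finset.sum_sub_distrib]
  rw [hsum]
  rcases isEmpty_or_nonempty (Fin m) with hm | hm
  · have hφ : g.phi = 0 := by
      have : ∀ S : Matrix (Fin m) (Fin m) ℝ, eigMin S = 0 := fun S => by
        have : rayleighSet S = ∅ := by
          ext r
          simp [rayleighSet]
        rw [eigMin, this, Real.sInf_empty]
      simp [phi, this]
    simp [frobNormSq, hφ]
  rcases isEmpty_or_nonempty (Fin d) with hd | hd
  · have hc : 0 ≤ c := (Real.sqrt_nonneg _).trans (hcle 0 hN)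
    have hφ := g.phi_pos
    simp only [frobNormSq, Finset.univ_eq_empty, Finset.sum_empty, Finset.sum_const_zero, mul_zero]
    have := hgap 0
    positivity
  have hc : 0 < c := (opNorm_pos (hK0.Gmat_posDef hN)).trans_le (hcle 0 hN)
  have hφ := g.phi_pos
  have hGc : ∀ k, ∀ t < N,
      (c • (1 : Matrix (Fin d) (Fin d) ℝ) - g.Gmat (Kseq k) t).PosSemidef := by
    intro k t ht
    have h0 := opNorm_smul_one_sub (hK0.Gmat_posDef ht).isHermitian
    have h1 : (c • (1 : Matrix (Fin d) (Fin d) ℝ)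
        - opNorm (g.Gmat K0 t) • (1 : Matrix (Fin d) (Fin d) ℝ)).PosSemidef := by
      rw [← sub_smul]
      exact Matrix.PosSemidef.one.smul (sub_nonneg.2 (hcle t ht))
    exact (h1.sub_trans h0).sub_trans ((hiter k).2 t ht)
  have htel : 2 * α * g.phi * ∑ k ∈ Finset.range M, ∑ t ∈ Finset.range N,
      frobNormSq (g.Fmat (Kseq k) t)
        ≤ c * (g.totalCost (Kseq 0) - g.totalCost (Kseq M)) := by
    rw [← Finset.sum_range_sub' (fun k => g.totalCost (Kseq k)), Finset.mul_sum, Finset.mul_sum]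
    refine Finset.sum_le_sum fun k _ => ?_
    have hs : g.IsGaussNewtonStep α (Kseq k) (Kseq (k + 1)) := hstep k
    exact hs.sum_frobNormSq_le hα0 hα (hiter k).1 hc hφ.le (hGc k)
  have hM' : (0 : ℝ) < M := Nat.cast_pos.2 hM
  rw [le_div_iff₀ (by positivity)]
  calc _ = 2 * α * g.phi * ∑ k ∈ Finset.range M, ∑ t ∈ Finset.range N,
        frobNormSq (g.Fmat (Kseq k) t) := by
        field_simp
    _ ≤ c * (g.totalCost (Kseq 0) - g.totalCost (Kseq M)) := htel
    _ ≤ _ := by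
      gcongr
      linarith [hgap M]
end
end

section
/- (Policy gradient formulas.) Fix a minimizer gain K. The map L ↦ G(K,L), from (ℝ^{n×m})^N to ℝ, is differentiable, and its Fréchet derivative at L in direction V = (V_t)_{t=0}^{N−1} equals Σ_{t=0}^{N−1} Tr((2 E^{K,L}_t X^{K,L}_t)ᵀ V_t). Likewise, for fixed L the map K ↦ G(K,L) is differentiable, and its Fréchet derivative at K in direction W = (W_t)_{t=0}^{N−1} equals Σ_{t=0}^{N−1} Tr((2 [(R^u_t + B_tᵀP^{K,L}_{t+1}B_t)K_t − B_tᵀP^{K,L}_{t+1}(A_t − D_tL_t)] X^{K,L}_t)ᵀ W_t). -/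
open Matrix

noncomputable section

attribute [local instance] Matrix.normedAddCommGroup Matrix.normedSpace

/-- The first function is Fréchet differentiable at `x`, with derivative acting as the second. -/
def HasDifferential {E F : Type*} [NormedAddCommGroup E] [NormedSpace ℝ E]
    [NormedAddCommGroup F] [NormedSpace ℝ F] (f f' : E → F) (x : E) : Prop :=
  ∃ D : E →L[ℝ] F, HasFDerivAt f D x ∧ ∀ v, D v = f' v

namespace HasDifferential

variable {E F : Type*} [NormedAddCommGroup E] [NormedSpace ℝ E]
  [NormedAddCommGroup F] [NormedSpace ℝ F] {x : E} {a b c : ℕ}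

theorem congr_right {f f' f'' : E → F} (h : HasDifferential f f' x) (h' : ∀ v, f' v = f'' v) :
    HasDifferential f f'' x := by
  obtain ⟨D, hD, hDv⟩ := h
  exact ⟨D, hD, fun v => (hDv v).trans (h' v)⟩

theorem const (y : F) : HasDifferential (fun _ : E => y) (fun _ => 0) x :=
  ⟨0, hasFDerivAt_const y x, fun _ => rfl⟩

theorem add {f f' g g' : E → F} (hf : HasDifferential f f' x) (hg : HasDifferential g g' x) :
    HasDifferential (fun y => f y + g y) (fun v => f' v + g' v) x := by
  obtain ⟨D, hD, hDv⟩ := hf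
  obtain ⟨D', hD', hDv'⟩ := hg
  exact ⟨D + D', hD.fun_add hD', fun v => by simp [hDv, hDv']⟩

theorem sub {f f' g g' : E → F} (hf : HasDifferential f f' x) (hg : HasDifferential g g' x) :
    HasDifferential (fun y => f y - g y) (fun v => f' v - g' v) x := by
  obtain ⟨D, hD, hDv⟩ := hf
  obtain ⟨D', hD', hDv'⟩ := hg
  exact ⟨D - D', hD.fun_sub hD', fun v => by simp [hDv, hDv']⟩

theorem sum {ι : Type*} {s : Finset ι} {f f' : ι → E → F}
    (h : ∀ i ∈ s, HasDifferential (f i) (f' i) x) :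
    HasDifferential (fun y => ∑ i ∈ s, f i y) (fun v => ∑ i ∈ s, f' i v) x := by
  classical
  induction s using Finset.induction_on with
  | empty => simpa using const (0 : F)
  | insert i s hi ih =>
    simp only [Finset.sum_insert hi]
    exact (h i (Finset.mem_insert_self i s)).add
      (ih fun j hj => h j (Finset.mem_insert_of_mem hj))

theorem linear_comp {G : Type*} [NormedAddCommGroup G] [NormedSpace ℝ G] [FiniteDimensional ℝ F]
    (T : F →ₗ[ℝ] G) {f f' : E → F} (hf : HasDifferential f f' x) :
    HasDifferential (fun y => T (f y)) (fun v => T (f' v)) x := by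
  obtain ⟨D, hD, hDv⟩ := hf
  exact ⟨T.toContinuousLinearMap.comp D, T.toContinuousLinearMap.hasFDerivAt.comp x hD,
    fun v => by simp [hDv]⟩

theorem matrix_mul {f f' : E → Matrix (Fin a) (Fin b) ℝ} {g g' : E → Matrix (Fin b) (Fin c) ℝ}
    (hf : HasDifferential f f' x) (hg : HasDifferential g g' x) :
    HasDifferential (fun y => f y * g y) (fun v => f x * g' v + f' v * g x) x := by
  obtain ⟨D, hD, hDv⟩ := hf
  obtain ⟨D', hD', hDv'⟩ := hg
  let T : Matrix (Fin a) (Fin b) ℝ →L[ℝ]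
      Matrix (Fin b) (Fin c) ℝ →L[ℝ] Matrix (Fin a) (Fin c) ℝ :=
    (mulLinearMap ℝ).toContinuousBilinearMap
  refine ⟨_, T.hasFDerivAt_of_bilinear hD hD', fun v => ?_⟩
  have h : T (f x) (D' v) + T (D v) (g x) = f x * g' v + f' v * g x :=
    congrArg₂ (fun S S' => f x * S + S' * g x) (hDv' v) (hDv v)
  exact h

theorem matrix_transpose {f f' : E → Matrix (Fin a) (Fin b) ℝ} (hf : HasDifferential f f' x) :
    HasDifferential (fun y => (f y)ᵀ) (fun v => (f' v)ᵀ) x :=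
  hf.linear_comp (Matrix.transposeLinearEquiv (Fin a) (Fin b) ℝ ℝ).toLinearMap

theorem matrix_trace {f f' : E → Matrix (Fin a) (Fin a) ℝ} (hf : HasDifferential f f' x) :
    HasDifferential (fun y => (f y).trace) (fun v => (f' v).trace) x :=
  hf.linear_comp (Matrix.traceLinearMap (Fin a) ℝ ℝ)

end HasDifferential

/-- Summation by parts for a backward Lyapunov recursion `Y` against the forward Lyapunov
recursion `X` with the same transition matrices. -/
theorem sum_trace_backward_eq_sum_trace_forward {m N : ℕ}
    {C Y X Δ Sig : ℕ → Matrix (Fin m) (Fin m) ℝ} (hYN : Y N = 0)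
    (hY : ∀ t < N, Y t = (C t)ᵀ * Y (t + 1) * C t + Δ t)
    (hX0 : X 0 = Sig 0) (hX : ∀ t < N, X (t + 1) = C t * X t * (C t)ᵀ + Sig (t + 1)) :
    ∑ t ∈ Finset.range (N + 1), (Y t * Sig t).trace
      = ∑ t ∈ Finset.range N, (Δ t * X t).trace := by
  have step : ∀ t < N, (Y (t + 1) * Sig (t + 1)).trace
      = (Y (t + 1) * X (t + 1)).trace - (Y t * X t).trace + (Δ t * X t).trace := by
    intro t ht
    have hcyc : ((C t)ᵀ * Y (t + 1) * C t * X t).trace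
        = (Y (t + 1) * (C t * X t * (C t)ᵀ)).trace := by
      rw [Matrix.mul_assoc, Matrix.mul_assoc, Matrix.trace_mul_comm, Matrix.mul_assoc]
    rw [hX t ht, hY t ht, Matrix.mul_add, Matrix.add_mul, Matrix.trace_add, Matrix.trace_add, hcyc]
    ring
  rw [Finset.sum_range_succ', Finset.sum_congr rfl fun t ht => step t (Finset.mem_range.mp ht),
    Finset.sum_add_distrib, Finset.sum_range_sub (fun t => (Y t * X t).trace), hYN, hX0]
  simp

theorem trace_symmetrized_mul {m k : ℕ} (M V : Matrix (Fin k) (Fin m) ℝ)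
    {X : Matrix (Fin m) (Fin m) ℝ} (hX : X.IsSymm) :
    ((Mᵀ * V + Vᵀ * M) * X).trace = (((2 : ℝ) • (M * X))ᵀ * V).trace := by
  have h₁ : (Mᵀ * V * X).trace = ((M * X)ᵀ * V).trace := by
    rw [Matrix.transpose_mul, hX.eq, Matrix.trace_mul_comm, Matrix.mul_assoc]
  have h₂ : (Vᵀ * M * X).trace = ((M * X)ᵀ * V).trace := by
    rw [← Matrix.trace_transpose, Matrix.mul_assoc, Matrix.transpose_mul,
      Matrix.transpose_transpose]
  rw [Matrix.add_mul, Matrix.trace_add, h₁, h₂, Matrix.transpose_smul, Matrix.smul_mul,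
    Matrix.trace_smul, smul_eq_mul, two_mul]

/-- Policy gradient of a finite-horizon quadratic cost in the feedback gains of one player. -/
theorem hasDifferential_quadratic_cost {m k N : ℕ}
    {A Q Sig X : ℕ → Matrix (Fin m) (Fin m) ℝ} {B : ℕ → Matrix (Fin m) (Fin k) ℝ}
    {R : ℕ → Matrix (Fin k) (Fin k) ℝ} {QN : Matrix (Fin m) (Fin m) ℝ}
    {P : (Fin N → Matrix (Fin k) (Fin m) ℝ) → ℕ → Matrix (Fin m) (Fin m) ℝ}
    (hQN : QN.IsSymm) (hQ : ∀ t < N, (Q t).IsSymm) (hR : ∀ t < N, (R t).IsSymm)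
    (hSig : ∀ t ≤ N, (Sig t).IsSymm) (hPN : ∀ F, P F N = QN)
    (hP : ∀ F, ∀ t < N, P F t = (A t - B t * padZero F t)ᵀ * P F (t + 1) *
      (A t - B t * padZero F t) + (Q t + (padZero F t)ᵀ * R t * padZero F t))
    (F : Fin N → Matrix (Fin k) (Fin m) ℝ) (hX0 : X 0 = Sig 0)
    (hX : ∀ t < N, X (t + 1) = (A t - B t * padZero F t) * X t *
      (A t - B t * padZero F t)ᵀ + Sig (t + 1)) :
    HasDifferential (fun F' => ∑ t ∈ Finset.range (N + 1), (P F' t * Sig t).trace)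
      (fun V => ∑ t : Fin N, (((2 : ℝ) • ((R t * padZero F t
        - (B t)ᵀ * P F (t + 1) * (A t - B t * padZero F t)) * X t))ᵀ * V t).trace) F := by
  have hPsymm : ∀ t ≤ N, (P F t).IsSymm := by
    intro t ht
    induction ht using Nat.decreasingInduction with
    | self => rw [hPN]; exact hQN
    | of_succ t ht ih =>
      rw [hP F t ht]
      simp only [Matrix.IsSymm, Matrix.transpose_add, Matrix.transpose_mul,
        Matrix.transpose_transpose, ih.eq, (hQ t ht).eq, (hR t ht).eq, Matrix.mul_assoc]
  have hXsymm : ∀ t ≤ N, (X t).IsSymm := by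
    intro t
    induction t with
    | zero => intro _; rw [hX0]; exact hSig 0 (Nat.zero_le N)
    | succ t ih =>
      intro ht
      rw [hX t ht]
      simp only [Matrix.IsSymm, Matrix.transpose_add, Matrix.transpose_mul,
        Matrix.transpose_transpose, (ih (Nat.le_of_succ_le ht)).eq, (hSig (t + 1) ht).eq,
        Matrix.mul_assoc]
  have hpad : ∀ t, HasDifferential
      (fun F' : Fin N → Matrix (Fin k) (Fin m) ℝ => padZero F' t) (fun V => padZero V t) F := by
    intro t
    by_cases ht : t < N
    · simp only [padZero, ht, dite_true]
      exact ⟨_, hasFDerivAt_apply (⟨t, ht⟩ : Fin N) F, fun _ => rfl⟩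
    · simp only [padZero, ht, dite_false]
      exact .const 0
  let M : ℕ → Matrix (Fin k) (Fin m) ℝ := fun t =>
    R t * padZero F t - (B t)ᵀ * P F (t + 1) * (A t - B t * padZero F t)
  have hstep : ∀ t < N, ∀ P' : (Fin N → Matrix (Fin k) (Fin m) ℝ) → Matrix (Fin m) (Fin m) ℝ,
      HasDifferential (fun F' => P F' (t + 1)) P' F →
      HasDifferential (fun F' => P F' t)
        (fun V => (A t - B t * padZero F t)ᵀ * P' V * (A t - B t * padZero F t)
          + ((M t)ᵀ * padZero V t + (padZero V t)ᵀ * M t)) F := by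
    intro t ht P' hP'
    have hC := (HasDifferential.const (x := F) (A t)).sub
      ((HasDifferential.const (x := F) (B t)).matrix_mul (hpad t))
    have hrec := ((hC.matrix_transpose.matrix_mul hP').matrix_mul hC).add
      ((HasDifferential.const (Q t)).add
        (((hpad t).matrix_transpose.matrix_mul (.const (R t))).matrix_mul (hpad t)))
    simp only [hP _ t ht]
    refine hrec.congr_right fun V => ?_
    simp only [M, Matrix.transpose_sub, Matrix.transpose_add, Matrix.transpose_mul,
      Matrix.transpose_transpose, (hPsymm (t + 1) ht).eq, (hR t ht).eq, Matrix.mul_sub,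
      Matrix.sub_mul, Matrix.mul_add, Matrix.add_mul, Matrix.mul_assoc, Matrix.zero_mul,
      Matrix.mul_zero, Matrix.transpose_zero]
    abel
  have hdiff : ∀ t ≤ N, DifferentiableAt ℝ (fun F' => P F' t) F := by
    intro t ht
    induction ht using Nat.decreasingInduction with
    | self => simp only [hPN]; exact differentiableAt_const QN
    | of_succ t ht ih =>
      obtain ⟨D, hD, -⟩ := hstep t ht _ ⟨_, ih.hasFDerivAt, fun _ => rfl⟩
      exact hD.differentiableAt
  have hP' : ∀ t ≤ N, HasDifferential (fun F' => P F' t) (fderiv ℝ (fun F' => P F' t) F) F :=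
    fun t ht => ⟨_, (hdiff t ht).hasFDerivAt, fun _ => rfl⟩
  have hsum := HasDifferential.sum (s := Finset.range (N + 1)) fun t ht =>
    ((hP' t (Finset.mem_range_succ_iff.mp ht)).matrix_mul (.const (Sig t))).matrix_trace
  refine hsum.congr_right fun V => ?_
  simp only [Matrix.mul_zero, zero_add]
  rw [sum_trace_backward_eq_sum_trace_forward (C := fun t => A t - B t * padZero F t)
    (Δ := fun t => (M t)ᵀ * padZero V t + (padZero V t)ᵀ * M t) (X := X)
    (by simp [hPN]) ?_ hX0 hX, Finset.sum_range]
  · refine Finset.sum_congr rfl fun t _ => ?_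
    rw [trace_symmetrized_mul _ _ (hXsymm t t.2.le)]
    simp [M, padZero]
  · intro t ht
    obtain ⟨D, hD, hDv⟩ := hstep t ht _ (hP' (t + 1) ht)
    exact (congrArg (fun T => T V) hD.fderiv).trans (hDv V)

namespace LQGame

variable {m d n N : ℕ}

theorem PKL_terminal (g : LQGame m d n N) (K : ℕ → Matrix (Fin d) (Fin m) ℝ)
    (L : ℕ → Matrix (Fin n) (Fin m) ℝ) : g.PKL K L N = g.QN := by
  simp [PKL, PKLaux]

theorem PKL_of_lt (g : LQGame m d n N) (K : ℕ → Matrix (Fin d) (Fin m) ℝ)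
    (L : ℕ → Matrix (Fin n) (Fin m) ℝ) {t : ℕ} (ht : t < N) :
    g.PKL K L t = (g.A t - g.B t * K t - g.D t * L t)ᵀ * g.PKL K L (t + 1) *
        (g.A t - g.B t * K t - g.D t * L t)
      + g.Q t + (K t)ᵀ * g.Ru t * K t - (L t)ᵀ * g.Rw t * L t := by
  have hsucc : N - t = N - (t + 1) + 1 := by omega
  have hback : N - (N - (t + 1) + 1) = t := by omega
  rw [PKL, hsucc, PKLaux, hback, ← PKL]

end LQGame

/-- policy gradient (Fréchet derivative) formulas for `G` in `L` and in `K`. -/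
theorem LQGame.policy_gradient_formulas {m d n N : ℕ} (g : LQGame m d n N) :
    (∀ (K : ℕ → Matrix (Fin d) (Fin m) ℝ) (LF : Fin N → Matrix (Fin n) (Fin m) ℝ),
      ∃ Df : (Fin N → Matrix (Fin n) (Fin m) ℝ) →L[ℝ] ℝ,
        HasFDerivAt (fun L' : Fin N → Matrix (Fin n) (Fin m) ℝ => g.value K (padZero L')) Df LF
        ∧ ∀ V : Fin N → Matrix (Fin n) (Fin m) ℝ,
            Df V = ∑ t : Fin N,
              (((2:ℝ) • (g.Emat K (padZero LF) t * g.Xcov K (padZero LF) t))ᵀ * V t).trace)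
    ∧ (∀ (KF : Fin N → Matrix (Fin d) (Fin m) ℝ) (L : ℕ → Matrix (Fin n) (Fin m) ℝ),
      ∃ Dg : (Fin N → Matrix (Fin d) (Fin m) ℝ) →L[ℝ] ℝ,
        HasFDerivAt (fun K' : Fin N → Matrix (Fin d) (Fin m) ℝ => g.value (padZero K') L) Dg KF
        ∧ ∀ W : Fin N → Matrix (Fin d) (Fin m) ℝ,
            Dg W = ∑ t : Fin N,
              (((2:ℝ) • (((g.Ru t + (g.B t)ᵀ * g.PKL (padZero KF) L (t+1) * g.B t) * padZero KF t
                  - (g.B t)ᵀ * g.PKL (padZero KF) L (t+1) * (g.A t - g.D t * L t))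
                  * g.Xcov (padZero KF) L t))ᵀ * W t).trace) := by
  have hQN := Matrix.isHermitian_iff_isSymm.mp g.hQN.isHermitian
  have hQ := fun t ht => Matrix.isHermitian_iff_isSymm.mp (g.hQ t ht).isHermitian
  have hRu := fun t ht => Matrix.isHermitian_iff_isSymm.mp (g.hRu t ht).isHermitian
  have hRw := fun t ht => Matrix.isHermitian_iff_isSymm.mp (g.hRw t ht).isHermitian
  have hSig := fun t ht => Matrix.isHermitian_iff_isSymm.mp (g.hSig t ht).isHermitian
  constructor
  · intro K LF
    refine (hasDifferential_quadratic_cost (A := fun t => g.A t - g.B t * K t) (B := g.D)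
      (Q := fun t => g.Q t + (K t)ᵀ * g.Ru t * K t) (R := fun t => -g.Rw t)
      (P := fun L' => g.PKL K (padZero L')) (X := g.Xcov K (padZero LF))
      hQN ?_ (fun t ht => (hRw t ht).neg) hSig (fun L' => g.PKL_terminal K (padZero L')) ?_
      LF rfl fun _ _ => rfl).congr_right fun V => Finset.sum_congr rfl fun t _ => ?_
    · intro t ht
      simp only [Matrix.IsSymm, Matrix.transpose_add, Matrix.transpose_mul,
        Matrix.transpose_transpose, (hQ t ht).eq, (hRu t ht).eq, Matrix.mul_assoc]
    · intro L' t ht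
      rw [g.PKL_of_lt K (padZero L') ht, Matrix.mul_neg, Matrix.neg_mul]
      abel
    · congr 5
      simp only [LQGame.Emat, Matrix.add_mul, Matrix.mul_sub, Matrix.mul_assoc]
      abel
  · intro KF L
    have hclosed : ∀ (K : ℕ → Matrix (Fin d) (Fin m) ℝ) (t : ℕ),
        g.A t - g.B t * K t - g.D t * L t = g.A t - g.D t * L t - g.B t * K t :=
      fun K t => sub_right_comm _ _ _
    refine (hasDifferential_quadratic_cost (A := fun t => g.A t - g.D t * L t) (B := g.B)
      (Q := fun t => g.Q t - (L t)ᵀ * g.Rw t * L t) (R := g.Ru)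
      (P := fun K' => g.PKL (padZero K') L) (X := g.Xcov (padZero KF) L)
      hQN ?_ hRu hSig (fun K' => g.PKL_terminal (padZero K') L) ?_
      KF rfl ?_).congr_right fun W => Finset.sum_congr rfl fun t _ => ?_
    · intro t ht
      simp only [Matrix.IsSymm, Matrix.transpose_sub, Matrix.transpose_mul,
        Matrix.transpose_transpose, (hQ t ht).eq, (hRw t ht).eq, Matrix.mul_assoc]
    · intro K' t ht
      rw [g.PKL_of_lt (padZero K') L ht, hclosed]
      abel
    · intro t _
      rw [LQGame.Xcov, hclosed]
    · congr 5
      simp only [Matrix.add_mul, Matrix.mul_sub, Matrix.mul_assoc]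
      abel
end
end

section
/- (Stationary points are the Nash equilibrium.) Suppose the gain pair (K,L) satisfies, for every t ∈ {0,…,N−1}: (i) E^{K,L}_t X^{K,L}_t = 0 and [(R^u_t + B_tᵀP^{K,L}_{t+1}B_t)K_t − B_tᵀP^{K,L}_{t+1}(A_t − D_tL_t)] X^{K,L}_t = 0 (vanishing policy gradients); (ii) P^{K,L}_t is positive semidefinite; and (iii) R^w_t − D_tᵀP^{K,L}_{t+1}D_t is positive definite. Then each Λ_t := I + (B_t(R^u_t)⁻¹B_tᵀ − D_t(R^w_t)⁻¹D_tᵀ)P^{K,L}_{t+1} is invertible, K_t = (R^u_t)⁻¹B_tᵀP^{K,L}_{t+1}Λ_t⁻¹A_t, L_t = −(R^w_t)⁻¹D_tᵀP^{K,L}_{t+1}Λ_t⁻¹A_t, and the value matrices satisfy the game Riccati recursion P^{K,L}_t = Q_t + A_tᵀP^{K,L}_{t+1}Λ_t⁻¹A_t. Consequently (K,L) is a saddle point of G, i.e. G(K,L̃) ≤ G(K,L) ≤ G(K̃,L) for all maximizer gains L̃ and minimizer gains K̃, and any two gain pairs satisfying (i)–(iii) coincide. -/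
open Matrix

noncomputable section

namespace LQGame

variable {m d n N : ℕ}

/-- `Λ_t` built from the value matrices of the pair `(K,L)`. -/
def LambdaKL (g : LQGame m d n N) (K : ℕ → Matrix (Fin d) (Fin m) ℝ)
    (L : ℕ → Matrix (Fin n) (Fin m) ℝ) (t : ℕ) : Matrix (Fin m) (Fin m) ℝ :=
  1 + (g.B t * (g.Ru t)⁻¹ * (g.B t)ᵀ - g.D t * (g.Rw t)⁻¹ * (g.D t)ᵀ) * g.PKL K L (t+1)

/-- Conditions (i)–(iii) of Statement 13: vanishing policy gradients, positive semidefinite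
value matrices, and positive definite `R^w_t − D_tᵀP^{K,L}_{t+1}D_t`. -/
def IsStationary (g : LQGame m d n N) (K : ℕ → Matrix (Fin d) (Fin m) ℝ)
    (L : ℕ → Matrix (Fin n) (Fin m) ℝ) : Prop :=
  ∀ t < N,
    g.Emat K L t * g.Xcov K L t = 0
    ∧ ((g.Ru t + (g.B t)ᵀ * g.PKL K L (t+1) * g.B t) * K t
        - (g.B t)ᵀ * g.PKL K L (t+1) * (g.A t - g.D t * L t)) * g.Xcov K L t = 0
    ∧ (g.PKL K L t).PosSemidef
    ∧ (g.Rw t - (g.D t)ᵀ * g.PKL K L (t+1) * g.D t).PosDef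

section MatrixLemmas

variable {ι κ μ : Type*}

/-- The trace of a product of two positive semidefinite real matrices is nonnegative. -/
theorem trace_mul_nonneg_of_posSemidef [Fintype ι] {S T : Matrix ι ι ℝ}
    (hS : S.PosSemidef) (hT : T.PosSemidef) : 0 ≤ (S * T).trace := by
  obtain ⟨k, v, rfl⟩ := Matrix.posSemidef_iff_eq_sum_vecMulVec.mp hT
  rw [Matrix.mul_sum, Matrix.trace_sum]
  refine Finset.sum_nonneg fun i _ => ?_
  rw [Matrix.mul_vecMulVec, Matrix.trace_vecMulVec, dotProduct_comm]
  exact hS.dotProduct_mulVec_nonneg (v i)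

theorem posSemidef_transpose_mul_mul [Fintype ι] [Fintype κ] {S : Matrix ι ι ℝ}
    (hS : S.PosSemidef) (C : Matrix ι κ ℝ) : (Cᵀ * S * C).PosSemidef := by
  simpa [Matrix.conjTranspose_eq_transpose_of_trivial] using hS.conjTranspose_mul_mul_same C

theorem transpose_eq_of_posSemidef {S : Matrix ι ι ℝ} (hS : S.PosSemidef) : Sᵀ = S := by
  simpa [Matrix.conjTranspose_eq_transpose_of_trivial] using hS.isHermitian.eq

theorem eq_zero_of_mul_posDef_eq_zero [Fintype ι] [DecidableEq ι] {S : Matrix ι ι ℝ}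
    (hS : S.PosDef) {C : Matrix κ ι ℝ} (h : C * S = 0) : C = 0 := by
  rw [← Matrix.mul_nonsing_inv_cancel_right (A := S) C
    ((Matrix.isUnit_iff_isUnit_det S).mp hS.isUnit), h, Matrix.zero_mul]

/-- Two quadratic forms, coupled antisymmetrically, vanish only at the origin. -/
theorem eq_zero_of_mulVec_coupled [Fintype κ] [Fintype μ] {S : Matrix κ κ ℝ}
    {T : Matrix μ μ ℝ} (hS : S.PosDef) (hT : T.PosDef) {C : Matrix κ μ ℝ} {u : κ → ℝ} {w : μ → ℝ}
    (hu : S *ᵥ u = C *ᵥ w) (hw : T *ᵥ w = -(Cᵀ *ᵥ u)) : u = 0 ∧ w = 0 := by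
  have hsum : u ⬝ᵥ S *ᵥ u + w ⬝ᵥ T *ᵥ w = 0 := by
    rw [hu, hw, dotProduct_neg, Matrix.mulVec_transpose, dotProduct_comm w,
      ← Matrix.dotProduct_mulVec, add_neg_cancel]
  have hu0 : 0 ≤ u ⬝ᵥ S *ᵥ u := by simpa using hS.posSemidef.dotProduct_mulVec_nonneg u
  have hw0 : 0 ≤ w ⬝ᵥ T *ᵥ w := by simpa using hT.posSemidef.dotProduct_mulVec_nonneg w
  constructor
  · by_contra hne
    have : 0 < u ⬝ᵥ S *ᵥ u := by simpa using hS.dotProduct_mulVec_pos hne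
    linarith
  · by_contra hne
    have : 0 < w ⬝ᵥ T *ᵥ w := by simpa using hT.dotProduct_mulVec_pos hne
    linarith

theorem isUnit_one_add_mul [Fintype ι] [Fintype κ] [Fintype μ]
    [DecidableEq ι] [DecidableEq κ] [DecidableEq μ] {B : Matrix ι κ ℝ} {D : Matrix ι μ ℝ}
    {P : Matrix ι ι ℝ} {Ru : Matrix κ κ ℝ} {Rw : Matrix μ μ ℝ}
    (hRu : Ru.PosDef) (hRw : Rw.PosDef) (hP : P.PosSemidef)
    (hH : (Rw - Dᵀ * P * D).PosDef) :
    IsUnit (1 + (B * Ru⁻¹ * Bᵀ - D * Rw⁻¹ * Dᵀ) * P) := by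
  rw [← Matrix.mulVec_injective_iff_isUnit]
  refine (injective_iff_map_eq_zero (Matrix.mulVecLin _)).mpr fun x hx => ?_
  rw [Matrix.mulVecLin_apply] at hx
  have hPT := transpose_eq_of_posSemidef hP
  have hRu' : Ru * Ru⁻¹ = 1 :=
    Matrix.mul_nonsing_inv Ru ((Matrix.isUnit_iff_isUnit_det Ru).mp hRu.isUnit)
  have hRw' : Rw * Rw⁻¹ = 1 :=
    Matrix.mul_nonsing_inv Rw ((Matrix.isUnit_iff_isUnit_det Rw).mp hRw.isUnit)
  obtain ⟨u, hu⟩ : ∃ u, u = (Ru⁻¹ * Bᵀ * P) *ᵥ x := ⟨_, rfl⟩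
  obtain ⟨w, hw⟩ : ∃ w, w = (Rw⁻¹ * Dᵀ * P) *ᵥ x := ⟨_, rfl⟩
  have hxe : x = D *ᵥ w - B *ᵥ u := by
    rw [hu, hw, Matrix.mulVec_mulVec, Matrix.mulVec_mulVec, ← sub_eq_zero, ← hx,
      Matrix.add_mulVec, Matrix.sub_mul, Matrix.sub_mulVec, Matrix.one_mulVec]
    simp only [Matrix.mul_assoc]
    abel
  have hRuu : Ru *ᵥ u = (Bᵀ * P) *ᵥ (D *ᵥ w - B *ᵥ u) := by
    rw [← hxe, hu, Matrix.mulVec_mulVec, ← Matrix.mul_assoc, ← Matrix.mul_assoc, hRu',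
      Matrix.one_mul]
  have hRww : Rw *ᵥ w = (Dᵀ * P) *ᵥ (D *ᵥ w - B *ᵥ u) := by
    rw [← hxe, hw, Matrix.mulVec_mulVec, ← Matrix.mul_assoc, ← Matrix.mul_assoc, hRw',
      Matrix.one_mul]
  obtain ⟨rfl, rfl⟩ := eq_zero_of_mulVec_coupled (C := Bᵀ * P * D)
    (hRu.add_posSemidef (posSemidef_transpose_mul_mul hP B)) hH (u := u) (w := w)
    (by rw [Matrix.add_mulVec, hRuu]; simp [Matrix.mulVec_sub, Matrix.mul_assoc])
    (by
      rw [Matrix.sub_mulVec, hRww]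
      simp [Matrix.mulVec_sub, Matrix.mul_assoc, hPT])
  simpa using hxe

/-- Completing the square around a gain whose first-order condition holds. -/
theorem value_step_perturb [Fintype ι] [Fintype κ] {P : Matrix ι ι ℝ}
    {C : Matrix ι κ ℝ} {R : Matrix κ κ ℝ} {M M' : Matrix ι μ ℝ} {K K' : Matrix κ μ ℝ}
    (hP : Pᵀ = P) (hR : Rᵀ = R)
    (hfoc : R * K = Cᵀ * P * M) (hM : M' = M - C * (K' - K)) :
    M'ᵀ * P * M' + K'ᵀ * R * K' =
      Mᵀ * P * M + Kᵀ * R * K + (K' - K)ᵀ * (R + Cᵀ * P * C) * (K' - K) := by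
  have hfoc' : Kᵀ * R = Mᵀ * P * C := by
    simpa [Matrix.transpose_mul, hP, hR, Matrix.mul_assoc] using congrArg transpose hfoc
  obtain ⟨Δ, hΔ⟩ : ∃ Δ, Δ = K' - K := ⟨_, rfl⟩
  obtain rfl : K' = K + Δ := by rw [hΔ]; abel
  rw [← hΔ] at *
  have h₁ : Δᵀ * (R * K) = Δᵀ * (Cᵀ * P * M) := by rw [hfoc]
  have h₂ : Kᵀ * R * Δ = Mᵀ * P * C * Δ := by rw [hfoc']
  subst hM
  simp only [Matrix.transpose_add, Matrix.transpose_sub, Matrix.transpose_mul, Matrix.add_mul,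
    Matrix.sub_mul, Matrix.mul_add, Matrix.mul_sub, Matrix.mul_assoc] at h₁ h₂ ⊢
  rw [h₁, h₂]
  abel

end MatrixLemmas

section

variable (g : LQGame m d n N) (K K' : ℕ → Matrix (Fin d) (Fin m) ℝ)
  (L L' : ℕ → Matrix (Fin n) (Fin m) ℝ)

/-- Closed-loop dynamics `A_t - B_t K_t - D_t L_t`. -/
def closedLoop (t : ℕ) : Matrix (Fin m) (Fin m) ℝ := g.A t - g.B t * K t - g.D t * L t

theorem PKL_of_le {t : ℕ} (ht : N ≤ t) : g.PKL K L t = g.QN := by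
  rw [PKL, Nat.sub_eq_zero_of_le ht, PKLaux]

theorem PKL_step {t : ℕ} (ht : t < N) :
    g.PKL K L t = (g.closedLoop K L t)ᵀ * g.PKL K L (t+1) * g.closedLoop K L t
      + g.Q t + (K t)ᵀ * g.Ru t * K t - (L t)ᵀ * g.Rw t * L t := by
  have h₁ : N - t = N - (t+1) + 1 := by omega
  have h₂ : N - (N - (t+1) + 1) = t := by omega
  rw [PKL, PKL, h₁, PKLaux, h₂, closedLoop]

theorem Xcov_posDef {t : ℕ} (ht : t ≤ N) : (g.Xcov K L t).PosDef := by
  induction t with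
  | zero => exact g.hSig 0 ht
  | succ t ih =>
    rw [Xcov, ← Matrix.conjTranspose_eq_transpose_of_trivial]
    exact (g.hSig _ ht).posSemidef_add
      ((ih (by omega)).posSemidef.mul_mul_conjTranspose_same _)

theorem value_le_value (h : ∀ t ≤ N, (g.PKL K' L' t - g.PKL K L t).PosSemidef) :
    g.value K L ≤ g.value K' L' := by
  refine Finset.sum_le_sum fun t ht => ?_
  have htN : t ≤ N := Nat.lt_succ_iff.mp (Finset.mem_range.mp ht)
  rw [← sub_nonneg, ← Matrix.trace_sub, ← Matrix.sub_mul]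
  exact trace_mul_nonneg_of_posSemidef (h t htN) (g.hSig t htN).posSemidef

variable {g K K' L L'}

namespace IsStationary

theorem PKL_posSemidef (hs : g.IsStationary K L) (t : ℕ) : (g.PKL K L t).PosSemidef := by
  rcases lt_or_ge t N with ht | ht
  · exact (hs t ht).2.2.1
  · rw [PKL_of_le g K L ht]
    exact g.hQN

theorem Ru_mul (hs : g.IsStationary K L) {t : ℕ} (ht : t < N) :
    g.Ru t * K t = (g.B t)ᵀ * g.PKL K L (t+1) * g.closedLoop K L t := by
  have h := eq_zero_of_mul_posDef_eq_zero (g.Xcov_posDef K L ht.le) (hs t ht).2.1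
  rw [← sub_eq_zero, ← h, closedLoop]
  simp only [Matrix.add_mul, Matrix.mul_sub, Matrix.mul_assoc]
  abel

theorem Rw_mul (hs : g.IsStationary K L) {t : ℕ} (ht : t < N) :
    g.Rw t * L t = -((g.D t)ᵀ * g.PKL K L (t+1) * g.closedLoop K L t) := by
  have h := eq_zero_of_mul_posDef_eq_zero (g.Xcov_posDef K L ht.le) (hs t ht).1
  rw [← sub_eq_zero, ← neg_eq_zero, ← h, closedLoop, Emat]
  simp only [Matrix.add_mul, Matrix.neg_mul, Matrix.mul_sub, Matrix.mul_assoc]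
  abel

theorem isUnit_LambdaKL (hs : g.IsStationary K L) {t : ℕ} (ht : t < N) :
    IsUnit (g.LambdaKL K L t) :=
  isUnit_one_add_mul (g.hRu t ht) (g.hRw t ht) (hs.PKL_posSemidef (t+1)) (hs t ht).2.2.2

theorem minimizer_gain_eq (hs : g.IsStationary K L) {t : ℕ} (ht : t < N) :
    K t = (g.Ru t)⁻¹ * (g.B t)ᵀ * g.PKL K L (t+1) * g.closedLoop K L t := by
  rw [Matrix.mul_assoc, Matrix.mul_assoc, ← Matrix.mul_assoc (g.B t)ᵀ, ← hs.Ru_mul ht,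
    Matrix.nonsing_inv_mul_cancel_left (A := g.Ru t) _
      ((Matrix.isUnit_iff_isUnit_det _).mp (g.hRu t ht).isUnit)]

theorem maximizer_gain_eq (hs : g.IsStationary K L) {t : ℕ} (ht : t < N) :
    L t = -((g.Rw t)⁻¹ * (g.D t)ᵀ * g.PKL K L (t+1) * g.closedLoop K L t) := by
  rw [Matrix.mul_assoc, Matrix.mul_assoc, ← Matrix.mul_assoc (g.D t)ᵀ, ← Matrix.mul_neg,
    ← hs.Rw_mul ht, Matrix.nonsing_inv_mul_cancel_left (A := g.Rw t) _
      ((Matrix.isUnit_iff_isUnit_det _).mp (g.hRw t ht).isUnit)]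

theorem LambdaKL_inv_mul (hs : g.IsStationary K L) {t : ℕ} (ht : t < N) :
    (g.LambdaKL K L t)⁻¹ * g.A t = g.closedLoop K L t := by
  have hΛ : g.LambdaKL K L t * g.closedLoop K L t = g.A t := by
    have hK := congrArg (g.B t * ·) (hs.minimizer_gain_eq ht)
    have hL := congrArg (g.D t * ·) (hs.maximizer_gain_eq ht)
    have hA : g.A t = g.closedLoop K L t + g.B t * K t + g.D t * L t := by
      rw [closedLoop]; abel
    simp only [Matrix.mul_neg] at hK hL
    rw [hA, hK, hL, LambdaKL]
    simp only [Matrix.add_mul, Matrix.sub_mul, Matrix.one_mul, Matrix.mul_assoc]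
    abel
  rw [← hΛ, Matrix.nonsing_inv_mul_cancel_left (A := g.LambdaKL K L t) _
    ((Matrix.isUnit_iff_isUnit_det _).mp (hs.isUnit_LambdaKL ht))]

theorem riccati (hs : g.IsStationary K L) {t : ℕ} (ht : t < N) :
    g.PKL K L t = g.Q t + (g.A t)ᵀ * g.PKL K L (t+1) * (g.LambdaKL K L t)⁻¹ * g.A t := by
  rw [Matrix.mul_assoc _ _ (g.A t), hs.LambdaKL_inv_mul ht, PKL_step g K L ht,
    Matrix.mul_assoc (K t)ᵀ, hs.Ru_mul ht, Matrix.mul_assoc (L t)ᵀ, hs.Rw_mul ht]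
  have hA : g.A t = g.closedLoop K L t + g.B t * K t + g.D t * L t := by
    rw [closedLoop]; abel
  rw [hA]
  simp only [Matrix.transpose_add, Matrix.transpose_mul, Matrix.add_mul, Matrix.mul_neg,
    Matrix.mul_assoc]
  abel

/-- Deviations of the minimizer increase the value matrices in the Loewner order. -/
theorem PKL_le_of_minimizer_deviation (hs : g.IsStationary K L)
    (K' : ℕ → Matrix (Fin d) (Fin m) ℝ) {t : ℕ} (ht : t ≤ N) :
    (g.PKL K' L t - g.PKL K L t).PosSemidef := by
  induction ht using Nat.decreasingInduction with
  | self => simpa [PKL_of_le] using Matrix.PosSemidef.zero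
  | of_succ t ht ih =>
    have hP := hs.PKL_posSemidef (t+1)
    have hstep := value_step_perturb (M' := g.closedLoop K' L t) (K' := K' t)
      (transpose_eq_of_posSemidef hP)
      (transpose_eq_of_posSemidef (g.hRu t ht).posSemidef) (hs.Ru_mul ht)
      (by simp only [closedLoop, Matrix.mul_sub]; abel)
    have hdiff : g.PKL K' L t - g.PKL K L t =
        (g.closedLoop K' L t)ᵀ * (g.PKL K' L (t+1) - g.PKL K L (t+1)) * g.closedLoop K' L t
        + (K' t - K t)ᵀ * (g.Ru t + (g.B t)ᵀ * g.PKL K L (t+1) * g.B t) * (K' t - K t) := by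
      rw [PKL_step g K' L ht, PKL_step g K L ht, Matrix.mul_sub, Matrix.sub_mul,
        eq_sub_of_add_eq' hstep.symm]
      abel
    rw [hdiff]
    exact (posSemidef_transpose_mul_mul ih _).add (posSemidef_transpose_mul_mul
      ((g.hRu t ht).posSemidef.add (posSemidef_transpose_mul_mul hP _)) _)

/-- Deviations of the maximizer decrease the value matrices in the Loewner order. -/
theorem PKL_le_of_maximizer_deviation (hs : g.IsStationary K L)
    (L' : ℕ → Matrix (Fin n) (Fin m) ℝ) {t : ℕ} (ht : t ≤ N) :
    (g.PKL K L t - g.PKL K L' t).PosSemidef := by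
  induction ht using Nat.decreasingInduction with
  | self => simpa [PKL_of_le] using Matrix.PosSemidef.zero
  | of_succ t ht ih =>
    have hP := hs.PKL_posSemidef (t+1)
    have hstep := value_step_perturb (M' := g.closedLoop K L' t) (K' := L' t) (R := -g.Rw t)
      (transpose_eq_of_posSemidef hP)
      (by rw [Matrix.transpose_neg, transpose_eq_of_posSemidef (g.hRw t ht).posSemidef])
      (by rw [Matrix.neg_mul, hs.Rw_mul ht, neg_neg])
      (by simp only [closedLoop, Matrix.mul_sub]; abel)
    have hdiff : g.PKL K L t - g.PKL K L' t =
        (g.closedLoop K L' t)ᵀ * (g.PKL K L (t+1) - g.PKL K L' (t+1)) * g.closedLoop K L' t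
        + (L' t - L t)ᵀ * (g.Rw t - (g.D t)ᵀ * g.PKL K L (t+1) * g.D t) * (L' t - L t) := by
      have hneg : g.Rw t - (g.D t)ᵀ * g.PKL K L (t+1) * g.D t =
          -(-g.Rw t + (g.D t)ᵀ * g.PKL K L (t+1) * g.D t) := by abel
      rw [PKL_step g K L' ht, PKL_step g K L ht, Matrix.mul_sub, Matrix.sub_mul, hneg,
        Matrix.mul_neg, Matrix.neg_mul, eq_sub_of_add_eq' hstep.symm]
      simp only [Matrix.mul_neg, Matrix.neg_mul]
      abel
    rw [hdiff]
    exact (posSemidef_transpose_mul_mul ih _).add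
      (posSemidef_transpose_mul_mul (hs t ht).2.2.2.posSemidef _)

theorem PKL_unique (hs : g.IsStationary K L) (hs' : g.IsStationary K' L') {t : ℕ}
    (ht : t ≤ N) : g.PKL K L t = g.PKL K' L' t := by
  induction ht using Nat.decreasingInduction with
  | self => simp [PKL_of_le]
  | of_succ t ht ih => rw [hs.riccati ht, hs'.riccati ht, LambdaKL, LambdaKL, ih]

end IsStationary

end

/-- stationary points are the Nash equilibrium of the game. -/
theorem stationary_is_nash (g : LQGame m d n N)
    (K : ℕ → Matrix (Fin d) (Fin m) ℝ) (L : ℕ → Matrix (Fin n) (Fin m) ℝ)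
    (hs : g.IsStationary K L) :
    (∀ t < N, IsUnit (g.LambdaKL K L t))
    ∧ (∀ t < N, K t = (g.Ru t)⁻¹ * (g.B t)ᵀ * g.PKL K L (t+1) * (g.LambdaKL K L t)⁻¹ * g.A t)
    ∧ (∀ t < N,
        L t = -((g.Rw t)⁻¹ * (g.D t)ᵀ * g.PKL K L (t+1) * (g.LambdaKL K L t)⁻¹ * g.A t))
    ∧ (∀ t < N,
        g.PKL K L t = g.Q t + (g.A t)ᵀ * g.PKL K L (t+1) * (g.LambdaKL K L t)⁻¹ * g.A t)
    ∧ (∀ L' : ℕ → Matrix (Fin n) (Fin m) ℝ, g.value K L' ≤ g.value K L)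
    ∧ (∀ K' : ℕ → Matrix (Fin d) (Fin m) ℝ, g.value K L ≤ g.value K' L)
    ∧ (∀ (K' : ℕ → Matrix (Fin d) (Fin m) ℝ) (L' : ℕ → Matrix (Fin n) (Fin m) ℝ),
        g.IsStationary K' L' → ∀ t < N, K t = K' t ∧ L t = L' t) := by
  have hK : ∀ {K : ℕ → Matrix (Fin d) (Fin m) ℝ} {L : ℕ → Matrix (Fin n) (Fin m) ℝ},
      g.IsStationary K L → ∀ t < N,
        K t = (g.Ru t)⁻¹ * (g.B t)ᵀ * g.PKL K L (t+1) * (g.LambdaKL K L t)⁻¹ * g.A t := by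
    intro K L hs t ht
    rw [Matrix.mul_assoc _ _ (g.A t), hs.LambdaKL_inv_mul ht, ← hs.minimizer_gain_eq ht]
  have hL : ∀ {K : ℕ → Matrix (Fin d) (Fin m) ℝ} {L : ℕ → Matrix (Fin n) (Fin m) ℝ},
      g.IsStationary K L → ∀ t < N,
        L t = -((g.Rw t)⁻¹ * (g.D t)ᵀ * g.PKL K L (t+1) * (g.LambdaKL K L t)⁻¹ * g.A t) := by
    intro K L hs t ht
    rw [Matrix.mul_assoc _ _ (g.A t), hs.LambdaKL_inv_mul ht, ← hs.maximizer_gain_eq ht]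
  refine ⟨fun t ht => hs.isUnit_LambdaKL ht, hK hs, hL hs, fun t ht => hs.riccati ht,
    fun L' => g.value_le_value _ _ _ _ fun t ht => hs.PKL_le_of_maximizer_deviation L' ht,
    fun K' => g.value_le_value _ _ _ _ fun t ht => hs.PKL_le_of_minimizer_deviation K' ht,
    fun K' L' hs' t ht => ⟨?_, ?_⟩⟩
  · rw [hK hs t ht, hK hs' t ht, LambdaKL, LambdaKL, hs.PKL_unique hs' ht]
  · rw [hL hs t ht, hL hs' t ht, LambdaKL, LambdaKL, hs.PKL_unique hs' ht]

end LQGame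
end
end
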